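/- arXiv:2406.05556 — 4 statements merged into one kernel-verified Lean document; each statement's English description precedes it below -/
import Mathlib

section
/- Let {μ_n}_{n≥1} be a sequence of positive reals satisfying μ_n = c₁ n^{-α₁} + c₂ n^{-α₂} + o(n^{-α₂}) as n → ∞, where c₁ > 0, c₂ ∈ ℝ, α₁, α₂ > 0, and either α₁ < α₂ < α₁ + 1/2, or α₁ = α₂ and c₂ = 0. Then the metric entropy, with respect to the ℓ²-norm, of the ℓ²-ellipsoid with semi-axes {μ_n} satisfies H(ε) = (α₁ c₁^{1/α₁}/ln 2) ε^{-1/α₁} + (c₂ c₁^{(1-α₂)/α₁}/(ln 2 (α₁-α₂+1))) ε^{-(α₁-α₂+1)/α₁} + o(ε^{-(α₁-α₂+1)/α₁}) as ε → 0. -/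
open MeasureTheory Filter Asymptotics Topology
open scoped BigOperators ENNReal NNReal

noncomputable section

/-- The `ε`-covering number of a set `K` in a (pseudo)metric space: the minimal cardinality of a
finite set of points such that every point of `K` lies within distance `ε` of one of them. -/
def coveringNumber {X : Type*} [PseudoMetricSpace X] (ε : ℝ) (K : Set X) : ℕ :=
  sInf {n : ℕ | ∃ s : Finset X, s.card = n ∧ ∀ x ∈ K, ∃ y ∈ s, dist x y ≤ ε}

/-- The metric entropy `H(ε; K) = log₂ N(ε; K)`. -/
def metricEntropy {X : Type*} [PseudoMetricSpace X] (ε : ℝ) (K : Set X) : ℝ :=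
  Real.logb 2 (coveringNumber ε K)

/-- The `ℓ²`-ellipsoid (over `ℝ`) with semi-axes `μ n` (here `μ n` is the semi-axis
`μ_{n+1}`). -/
def ellipsoid (μ : ℕ → ℝ) : Set (lp (fun _ : ℕ => ℝ) 2) :=
  {y | (Summable fun n => ((y : ∀ _ : ℕ, ℝ) n / μ n) ^ 2)
    ∧ ∑' n, ((y : ∀ _ : ℕ, ℝ) n / μ n) ^ 2 ≤ 1}

open scoped RealInnerProductSpace

section EuclideanCovering

variable {E : Type*} [NormedAddCommGroup E] [InnerProductSpace ℝ E] [FiniteDimensional ℝ E]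
  [MeasurableSpace E] [BorelSpace E]

/-- Among all parallel slabs of the same width, the central one meets a ball in the largest
volume. -/
lemma measureReal_closedBall_le_central_slab (x : E) {H w : ℝ} (hw : 0 < w) (L : ℕ)
    (hL : H * ‖x‖ ≤ 2 * L * w) :
    volume.real (Metric.closedBall (0 : E) H) ≤
      (2 * L + 1) * volume.real (Metric.closedBall (0 : E) H ∩ {u | |⟪u, x⟫| ≤ w}) := by
  set S : Set E := Metric.closedBall (0 : E) H ∩ {u | |⟪u, x⟫| ≤ w} with hS
  set v : ℤ → E := fun i => (2 * w * i / ‖x‖ ^ 2) • x with hv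
  have hSfin : volume S ≠ ∞ :=
    measure_ne_top_of_subset Set.inter_subset_left measure_closedBall_lt_top.ne
  have hcover : Metric.closedBall (0 : E) H ⊆
      ⋃ i ∈ Finset.Icc (-(L : ℤ)) L, (fun u => v i + u) '' S := by
    intro u hu
    have hu' : ‖u‖ ≤ H := by simpa using hu
    rcases eq_or_ne x 0 with rfl | hx
    · refine Set.mem_biUnion (x := 0) (by simp) ⟨u, ⟨hu, by simp [hw.le]⟩, by simp [hv]⟩
    have hxpos : 0 < ‖x‖ := norm_pos_iff.2 hx
    set c := ⟪u, x⟫ with hc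
    have hcabs : |c| ≤ 2 * L * w :=
      (abs_real_inner_le_norm u x).trans ((by gcongr : ‖u‖ * ‖x‖ ≤ H * ‖x‖).trans hL)
    set i := round (c / (2 * w)) with hi
    have hround : |c - 2 * w * i| ≤ w := by
      have h1 := abs_sub_round (c / (2 * w))
      have h2 : c - 2 * w * i = (2 * w) * (c / (2 * w) - i) := by field_simp
      rw [h2, abs_mul, abs_of_pos (by positivity : 0 < 2 * w)]
      rw [← hi] at h1
      nlinarith
    obtain ⟨h1, h2⟩ := abs_le.1 hround
    obtain ⟨h3, h4⟩ := abs_le.1 hcabs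
    have hiL : i ≤ L := by
      by_contra! hlt
      have : (L : ℝ) + 1 ≤ i := by exact_mod_cast hlt
      nlinarith
    have hiL' : -(L : ℤ) ≤ i := by
      by_contra! hlt
      have : (i : ℝ) + 1 ≤ -L := by exact_mod_cast hlt
      nlinarith
    refine Set.mem_biUnion (x := i) (by simp [hiL, hiL']) ⟨u - v i, ⟨?_, ?_⟩, by simp⟩
    · rw [mem_closedBall_zero_iff]
      refine le_trans ?_ hu'
      refine abs_le_of_sq_le_sq' ?_ (norm_nonneg _) |>.2
      rw [@norm_sub_sq_real]
      simp only [hv, inner_smul_right, norm_smul, ← hc, mul_pow, Real.norm_eq_abs, sq_abs]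
      have key : (i : ℝ) * (w * i - c) ≤ 0 := by
        rcases lt_trichotomy i 0 with hneg | hzero | hpos
        · have : (i : ℝ) ≤ -1 := by exact_mod_cast Int.le_sub_one_of_lt hneg
          exact mul_nonpos_of_nonpos_of_nonneg (by linarith) (by nlinarith)
        · simp [hzero]
        · have : (1 : ℝ) ≤ i := by exact_mod_cast hpos
          exact mul_nonpos_of_nonneg_of_nonpos (by linarith) (by nlinarith)
      have h5 : ‖u‖ ^ 2 - 2 * (2 * w * i / ‖x‖ ^ 2 * c) + (2 * w * i / ‖x‖ ^ 2) ^ 2 * ‖x‖ ^ 2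
          = ‖u‖ ^ 2 + 4 * w / ‖x‖ ^ 2 * (i * (w * i - c)) := by field_simp; ring
      rw [h5]
      have : 0 ≤ 4 * w / ‖x‖ ^ 2 := by positivity
      nlinarith
    · have h6 : ⟪u - v i, x⟫ = c - 2 * w * i := by
        simp only [hv, inner_sub_left, inner_smul_left, real_inner_self_eq_norm_sq, ← hc]
        simp; field_simp
      rw [Set.mem_ofPred_eq, h6]; exact hround
  calc volume.real (Metric.closedBall (0 : E) H)
      ≤ volume.real (⋃ i ∈ Finset.Icc (-(L : ℤ)) L, (fun u => v i + u) '' S) := by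
        refine measureReal_mono hcover ?_
        refine ((measure_biUnion_finset_le _ _).trans_lt ?_).ne
        refine ENNReal.sum_lt_top.2 fun i _ => ?_
        rw [Set.image_add_left, measure_preimage_add]; exact hSfin.lt_top
    _ ≤ ∑ i ∈ Finset.Icc (-(L : ℤ)) L, volume.real ((fun u => v i + u) '' S) :=
        measureReal_biUnion_finset_le _ _
    _ = ∑ i ∈ Finset.Icc (-(L : ℤ)) L, volume.real S := by
        refine Finset.sum_congr rfl fun i _ => ?_
        rw [measureReal_def, Set.image_add_left, measure_preimage_add, measureReal_def]
    _ = (2 * L + 1) * volume.real S := by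
        rw [Finset.sum_const, Int.card_Icc, nsmul_eq_mul]
        congr 1
        have : ((L : ℤ) + 1 - -(L : ℤ)).toNat = 2 * L + 1 := by omega
        rw [this]; push_cast; ring

/-- The intersection of two balls whose boundary spheres meet orthogonally contains a translate of a
central slab of the ball spanned by the common section. -/
lemma translate_slab_subset_lens {E : Type*} [NormedAddCommGroup E] [InnerProductSpace ℝ E]
    {x : E} {r a H w : ℝ} (ha : 0 ≤ a) (ha1 : a ≤ 1) (hr : 0 ≤ r)
    (hx : ‖x‖ ≤ r) (hH : H ^ 2 + 2 * w ≤ a * (1 - a) * r ^ 2) :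
    (fun u => a • x + u) '' (Metric.closedBall (0 : E) H ∩ {u | |⟪u, x⟫| ≤ w}) ⊆
      Metric.closedBall 0 (r * √a) ∩ Metric.closedBall x (r * √(1 - a)) := by
  rintro _ ⟨u, ⟨hu, huw⟩, rfl⟩
  have hu' : ‖u‖ ≤ H := by simpa using hu
  have hu2 : ‖u‖ ^ 2 ≤ H ^ 2 := by gcongr
  have hx2 : ‖x‖ ^ 2 ≤ r ^ 2 := by gcongr
  obtain ⟨h1, h2⟩ := abs_le.1 (show |⟪u, x⟫| ≤ w from huw)
  have hw : 0 ≤ w := by linarith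
  have hb : 0 ≤ 1 - a := by linarith
  constructor
  · rw [mem_closedBall_zero_iff]
    refine abs_le_of_sq_le_sq' ?_ (by positivity) |>.2
    rw [mul_pow, Real.sq_sqrt ha, @norm_add_sq_real, norm_smul, inner_smul_left,
      real_inner_comm]
    simp only [mul_pow, Real.norm_eq_abs, sq_abs, conj_trivial]
    nlinarith [mul_le_mul_of_nonneg_left hx2 (sq_nonneg a), mul_le_mul_of_nonneg_left h2 ha,
      mul_nonneg hb hw]
  · rw [Metric.mem_closedBall, dist_eq_norm]
    refine abs_le_of_sq_le_sq' ?_ (by positivity) |>.2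
    have h3 : a • x + u - x = u - (1 - a) • x := by module
    rw [mul_pow, Real.sq_sqrt hb, h3, @norm_sub_sq_real, norm_smul, inner_smul_right]
    simp only [mul_pow, Real.norm_eq_abs, sq_abs]
    nlinarith [mul_le_mul_of_nonneg_left hx2 (sq_nonneg (1 - a)), mul_le_mul_of_nonneg_left h1 hb,
      mul_nonneg ha hw]

lemma one_add_inv_pow_le_three (m : ℕ) : (1 + (m : ℝ)⁻¹) ^ m ≤ 3 := by
  have h1 : 1 + (m : ℝ)⁻¹ ≤ Real.exp ((m : ℝ)⁻¹) := by
    rw [add_comm]; exact Real.add_one_le_exp _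
  calc (1 + (m : ℝ)⁻¹) ^ m ≤ Real.exp ((m : ℝ)⁻¹) ^ m := by gcongr
    _ = Real.exp (m * (m : ℝ)⁻¹) := (Real.exp_nat_mul _ _).symm
    _ ≤ Real.exp 1 := by
        gcongr
        exact mul_inv_le_one
    _ ≤ 3 := Real.exp_one_lt_three.le

/-- A ball of radius `r √(1 - a)` centred in the ball of radius `r` captures at least a fraction of
order `(1 - a) ^ (m / 2)`, up to a polynomial factor, of the concentric ball of radius `r √a`. -/
lemma measureReal_closedBall_le_lens {x : E} {r a : ℝ} (hm : 0 < Module.finrank ℝ E)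
    (ha : 0 < a) (ha1 : a < 1) (hr : 0 < r) (hx : ‖x‖ ≤ r) (L : ℕ)
    (hL : (Module.finrank ℝ E + 1) / (√a * √(1 - a)) ≤ L) :
    volume.real (Metric.closedBall (0 : E) (r * √a)) ≤
      3 * (2 * L + 1) * (1 / √(1 - a)) ^ Module.finrank ℝ E *
        volume.real (Metric.closedBall (0 : E) (r * √a) ∩ Metric.closedBall x (r * √(1 - a))) := by
  set m := Module.finrank ℝ E with hmdef
  have hb : 0 < 1 - a := by linarith
  have hmR : (0 : ℝ) < m := by exact_mod_cast hm
  set h : ℝ := r * √a * √(1 - a) with hh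
  have hhpos : 0 < h := by positivity
  have hh2 : h ^ 2 = a * (1 - a) * r ^ 2 := by
    rw [hh, mul_pow, mul_pow, Real.sq_sqrt ha.le, Real.sq_sqrt hb.le]; ring
  set q : ℝ := (1 + (m : ℝ)⁻¹)⁻¹ with hq
  have hqm : q = m / (m + 1) := by rw [hq]; field_simp
  have hq0 : 0 < q := by positivity
  have hq1 : q ≤ 1 := by rw [hqm, div_le_one (by positivity)]; linarith
  set w : ℝ := h ^ 2 / (2 * (m + 1)) with hw
  have hwpos : 0 < w := by positivity
  have hHw : (q * h) ^ 2 + 2 * w ≤ a * (1 - a) * r ^ 2 := by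
    rw [← hh2]
    have h1 : 2 * w = (1 - q) * h ^ 2 := by rw [hw, hqm]; field_simp; ring
    rw [h1, mul_pow]
    nlinarith [mul_nonneg (mul_nonneg hq0.le (sub_nonneg.2 hq1)) (sq_nonneg h)]
  have hLx : (q * h) * ‖x‖ ≤ 2 * L * w := by
    rw [div_le_iff₀ (by positivity)] at hL
    calc (q * h) * ‖x‖ ≤ (1 * h) * r := by gcongr
      _ ≤ 2 * L * w := by
        have h2 : 2 * L * w = (L * (√a * √(1 - a))) * (r * h) / (m + 1) := by
          rw [hw, sq, hh]; field_simp
        rw [h2, le_div_iff₀ (by positivity)]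
        nlinarith [mul_pos hr hhpos]
  have hslab := measureReal_closedBall_le_central_slab x hwpos L hLx
  have hsub := translate_slab_subset_lens ha.le ha1.le hr.le hx hHw
  have hlens : volume.real (Metric.closedBall (0 : E) (q * h) ∩ {u | |⟪u, x⟫| ≤ w}) ≤
      volume.real
        (Metric.closedBall (0 : E) (r * √a) ∩ Metric.closedBall x (r * √(1 - a))) := by
    refine le_trans (le_of_eq ?_) (measureReal_mono hsub
      (measure_ne_top_of_subset Set.inter_subset_left measure_closedBall_lt_top.ne))
    rw [measureReal_def, measureReal_def, Set.image_add_left, measure_preimage_add]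
  have hvol : volume.real (Metric.closedBall (0 : E) (r * √a)) =
      (1 / (q * √(1 - a))) ^ m * volume.real (Metric.closedBall (0 : E) (q * h)) := by
    rw [Measure.addHaar_real_closedBall _ _ (by positivity),
      Measure.addHaar_real_closedBall _ _ (by positivity), ← mul_assoc, ← mul_pow]
    congr 2
    rw [hh]; field_simp
  have hq3 : (1 / q) ^ m ≤ 3 := by
    rw [hq, one_div, inv_inv]; exact one_add_inv_pow_le_three m
  rw [hvol, ← one_div_mul_one_div_rev, mul_pow]
  calc _ ≤ (1 / √(1 - a)) ^ m * 3 * ((2 * L + 1) * volume.real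
        (Metric.closedBall (0 : E) (r * √a) ∩ Metric.closedBall x (r * √(1 - a)))) := by
        gcongr
        exact hslab.trans (by gcongr)
    _ = _ := by ring

/-- If every point of a nonempty finite set is captured by at least a fraction `p` of the possible
centres in `C`, some centre captures a fraction `p` of the points. -/
lemma exists_center_capturing (U : Finset E) {C : Set E}
    (hC0 : volume C ≠ 0) (hC : volume C ≠ ∞) {ρ p : ℝ}
    (hp : ∀ t ∈ U, p * volume.real C ≤ volume.real (C ∩ Metric.closedBall t ρ)) :
    ∃ y, p * U.card ≤ ((U.filter fun t => dist t y ≤ ρ).card : ℝ) := by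
  classical
  have : IsFiniteMeasure (volume.restrict C) := ⟨by simpa using hC.lt_top⟩
  set f : E → ℝ := fun y => ∑ t ∈ U, (Metric.closedBall t ρ).indicator 1 y with hf
  have hball_int : ∀ t ∈ U, Integrable ((Metric.closedBall t ρ).indicator (1 : E → ℝ))
      (volume.restrict C) := fun t _ =>
    (integrable_const (1 : ℝ)).indicator Metric.isClosed_closedBall.measurableSet
  have hfint : IntegrableOn f C := integrable_finsetSum _ hball_int
  obtain ⟨y, -, hy⟩ := exists_setAverage_le hC0 hC hfint
  refine ⟨y, ?_⟩
  have hval : f y = ((U.filter fun t => dist t y ≤ ρ).card : ℝ) := by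
    simp only [hf, Finset.card_filter, Nat.cast_sum, Set.indicator_apply, Metric.mem_closedBall,
      dist_comm y, Pi.one_apply]
    exact Finset.sum_congr rfl fun t _ => by split_ifs <;> simp
  rw [← hval]
  refine le_trans ?_ hy
  have hpos : 0 < volume.real C := ENNReal.toReal_pos hC0 hC
  rw [setAverage_eq, smul_eq_mul, ← div_eq_inv_mul, le_div_iff₀ hpos, hf,
    integral_finsetSum _ hball_int]
  calc p * U.card * volume.real C = ∑ t ∈ U, p * volume.real C := by
        rw [Finset.sum_const, nsmul_eq_mul]; ring
    _ ≤ _ := by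
        refine Finset.sum_le_sum fun t ht => (hp t ht).trans (le_of_eq ?_)
        rw [integral_indicator_one Metric.isClosed_closedBall.measurableSet, measureReal_def,
          measureReal_def, Measure.restrict_apply Metric.isClosed_closedBall.measurableSet,
          Set.inter_comm]

/-- Greedy covering of a finite set. -/
lemma exists_greedy_cover (T : Finset E) {C : Set E}
    (hC0 : volume C ≠ 0) (hC : volume C ≠ ∞) {ρ p : ℝ} (hp0 : 0 < p) (hp1 : p ≤ 1)
    (hp : ∀ t ∈ T, p * volume.real C ≤ volume.real (C ∩ Metric.closedBall t ρ)) :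
    ∃ F : Finset E, (F.card : ℝ) ≤ Real.log T.card / p + 1 ∧ ∀ t ∈ T, ∃ y ∈ F, dist t y ≤ ρ := by
  classical
  have step : ∀ k : ℕ, ∃ F : Finset E, F.card ≤ k ∧
      ((T.filter fun t => ¬ ∃ y ∈ F, dist t y ≤ ρ).card : ℝ) ≤ (1 - p) ^ k * T.card := by
    intro k
    induction k with
    | zero => exact ⟨∅, by simp, by simp⟩
    | succ k ih =>
      obtain ⟨F, hF, hcard⟩ := ih
      set U := T.filter fun t => ¬ ∃ y ∈ F, dist t y ≤ ρ with hU
      obtain ⟨y, hy⟩ := exists_center_capturing U hC0 hC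
        fun t ht => hp t (Finset.mem_of_mem_filter t ht)
      refine ⟨insert y F, (Finset.card_insert_le _ _).trans (by omega), ?_⟩
      have hsub : (T.filter fun t => ¬ ∃ z ∈ insert y F, dist t z ≤ ρ) ⊆
          U.filter fun t => ¬ dist t y ≤ ρ := by
        intro t ht
        simp only [hU, Finset.mem_filter, Finset.mem_insert, not_exists, not_and] at ht ⊢
        exact ⟨⟨ht.1, fun z hz => ht.2 z (Or.inr hz)⟩, ht.2 y (Or.inl rfl)⟩
      have hsplit := Finset.card_filter_add_card_filter_not (s := U) (fun t => dist t y ≤ ρ)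
      have h1 : ((U.filter fun t => ¬ dist t y ≤ ρ).card : ℝ) ≤ (1 - p) * U.card := by
        have : ((U.filter fun t => dist t y ≤ ρ).card : ℝ)
          + ((U.filter fun t => ¬ dist t y ≤ ρ).card : ℝ) = U.card := by exact_mod_cast hsplit
        linarith
      calc _ ≤ ((U.filter fun t => ¬ dist t y ≤ ρ).card : ℝ) := by
            exact_mod_cast Finset.card_le_card hsub
        _ ≤ (1 - p) * U.card := h1
        _ ≤ (1 - p) * ((1 - p) ^ k * T.card) := by gcongr
        _ = _ := by ring
  rcases T.eq_empty_or_nonempty with rfl | hT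
  · exact ⟨∅, by simp, by simp⟩
  have hTpos : (0 : ℝ) < T.card := by exact_mod_cast hT.card_pos
  have hlog : 0 ≤ Real.log T.card := Real.log_natCast_nonneg _
  obtain ⟨F, hF, hcard⟩ := step (⌊Real.log T.card / p⌋₊ + 1)
  refine ⟨F, ?_, ?_⟩
  · calc (F.card : ℝ) ≤ ((⌊Real.log T.card / p⌋₊ + 1 : ℕ) : ℝ) := by exact_mod_cast hF
      _ ≤ _ := by
        push_cast
        gcongr
        exact Nat.floor_le (by positivity)
  · have hlt : (1 - p) ^ (⌊Real.log T.card / p⌋₊ + 1) * T.card < 1 := by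
      have h2 : (1 - p) ^ (⌊Real.log T.card / p⌋₊ + 1) ≤
          Real.exp (-p) ^ (⌊Real.log T.card / p⌋₊ + 1) := by
        gcongr
        linarith [Real.add_one_le_exp (-p)]
      have h3 : Real.log T.card < p * (⌊Real.log T.card / p⌋₊ + 1) := by
        rw [← div_lt_iff₀' hp0]; exact Nat.lt_floor_add_one _
      rw [← Real.exp_nat_mul] at h2
      calc _ ≤ Real.exp (((⌊Real.log T.card / p⌋₊ + 1 : ℕ) : ℝ) * -p) * T.card := by gcongr
        _ < Real.exp (- Real.log T.card) * T.card := by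
          gcongr; push_cast; linarith
        _ = 1 := by rw [Real.exp_neg, Real.exp_log hTpos]; field_simp
    have h0 : (T.filter fun t => ¬ ∃ y ∈ F, dist t y ≤ ρ).card = 0 := by
      have : ((T.filter fun t => ¬ ∃ y ∈ F, dist t y ≤ ρ).card : ℝ) < 1 := hcard.trans_lt hlt
      exact_mod_cast Nat.lt_one_iff.1 (by exact_mod_cast this)
    intro t ht
    by_contra hcon
    have : t ∈ T.filter fun t => ¬ ∃ y ∈ F, dist t y ≤ ρ :=
      Finset.mem_filter.2 ⟨ht, hcon⟩
    rw [Finset.card_eq_zero.1 h0] at this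
    simp at this

/-- Volumetric bound on separated subsets of a ball. -/
lemma card_le_of_separated_closedBall {r δ : ℝ} (hr : 0 ≤ r) (hδ : 0 < δ) (T : Finset E)
    (hT : ∀ t ∈ T, ‖t‖ ≤ r) (hsep : ∀ t ∈ T, ∀ t' ∈ T, t ≠ t' → δ < dist t t') :
    (T.card : ℝ) ≤ (1 + 2 * r / δ) ^ Module.finrank ℝ E := by
  have hpos : 0 < volume.real (Metric.ball (0 : E) 1) :=
    ENNReal.toReal_pos (Metric.measure_ball_pos _ _ one_pos).ne' measure_ball_lt_top.ne
  have hdisj : (T : Set E).PairwiseDisjoint fun t => Metric.ball t (δ / 2) := by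
    intro t ht t' ht' hne
    refine Metric.ball_disjoint_ball ?_
    linarith [hsep t ht t' ht' hne]
  have hsub : (⋃ t ∈ T, Metric.ball t (δ / 2)) ⊆ Metric.ball 0 (r + δ / 2) := by
    refine Set.iUnion₂_subset fun t ht => Metric.ball_subset_ball' ?_
    rw [dist_zero_right]; linarith [hT t ht]
  have h1 := measureReal_mono hsub (measure_ball_lt_top (μ := volume)).ne
  rw [measureReal_biUnion_finset hdisj (fun _ _ => measurableSet_ball)
    (fun _ _ => measure_ball_lt_top.ne)] at h1
  have hball : ∀ (x : E) {s : ℝ}, 0 < s → volume.real (Metric.ball x s) =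
      s ^ Module.finrank ℝ E * volume.real (Metric.ball (0 : E) 1) := fun x s hs => by
    rw [measureReal_def, Measure.addHaar_ball_of_pos _ _ hs, ENNReal.toReal_mul,
      ENNReal.toReal_ofReal (by positivity), measureReal_def]
  simp only [fun x : E => hball x (by positivity : 0 < δ / 2),
    hball 0 (by positivity : 0 < r + δ / 2)] at h1
  rw [Finset.sum_const, nsmul_eq_mul, ← mul_assoc] at h1
  have h2 := le_of_mul_le_mul_right h1 hpos
  rw [← le_div_iff₀ (by positivity), ← div_pow] at h2
  have h3 : (r + δ / 2) / (δ / 2) = 1 + 2 * r / δ := by field_simp; ring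
  rwa [h3] at h2

lemma exists_net_closedBall {r δ : ℝ} (hr : 0 ≤ r) (hδ : 0 < δ) :
    ∃ T : Finset E, (∀ t ∈ T, ‖t‖ ≤ r) ∧ (∀ x : E, ‖x‖ ≤ r → ∃ t ∈ T, dist x t ≤ δ) ∧
      (T.card : ℝ) ≤ (1 + 2 * r / δ) ^ Module.finrank ℝ E := by
  classical
  let P : ℕ → Prop := fun n => ∃ T : Finset E, T.card = n ∧ (∀ t ∈ T, ‖t‖ ≤ r) ∧
    ∀ t ∈ T, ∀ t' ∈ T, t ≠ t' → δ < dist t t'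
  set B := ⌊(1 + 2 * r / δ) ^ Module.finrank ℝ E⌋₊ with hB
  have hP0 : P 0 := ⟨∅, by simp⟩
  obtain ⟨T, hcard, hT, hsep⟩ : P (Nat.findGreatest P B) := Nat.findGreatest_spec (Nat.zero_le _) hP0
  refine ⟨T, hT, fun x hx => ?_, card_le_of_separated_closedBall hr hδ T hT hsep⟩
  by_contra! hcon
  have hxT : x ∉ T := fun h => by have := hcon x h; simp at this; linarith
  have hT' : ∀ t ∈ insert x T, ‖t‖ ≤ r := by
    simp only [Finset.mem_insert, forall_eq_or_imp]; exact ⟨hx, hT⟩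
  have hsep' : ∀ t ∈ insert x T, ∀ t' ∈ insert x T, t ≠ t' → δ < dist t t' := by
    intro t ht t' ht' hne
    rcases Finset.mem_insert.1 ht with rfl | hmem <;>
      rcases Finset.mem_insert.1 ht' with rfl | hmem'
    · exact absurd rfl hne
    · exact hcon t' hmem'
    · rw [dist_comm]; exact hcon t hmem
    · exact hsep t hmem t' hmem' hne
  have hle : (insert x T).card ≤ B :=
    Nat.le_floor (card_le_of_separated_closedBall hr hδ _ hT' hsep')
  have hP : P (insert x T).card := ⟨_, rfl, hT', hsep'⟩
  have := Nat.le_findGreatest hle hP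
  rw [Finset.card_insert_of_notMem hxT] at this
  omega

/-- A Euclidean ball of radius `r` is covered by `(r / ρ) ^ m` balls of radius slightly larger than
`ρ`, up to a polynomial factor. -/
lemma exists_cover_closedBall {r ρ η : ℝ} (hm : 0 < Module.finrank ℝ E) (hρ : 0 < ρ) (hρr : ρ ≤ r)
    (hη : 0 < η) (hη1 : η ≤ 1) :
    ∃ F : Finset E, (∀ x : E, ‖x‖ ≤ r → ∃ y ∈ F, dist x y ≤ ρ * (1 + η)) ∧
      (F.card : ℝ) ≤ 126 * (Module.finrank ℝ E + 1) ^ 3 * (r / ρ) ^ 2 / η *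
        (r / ρ) ^ Module.finrank ℝ E := by
  set m := Module.finrank ℝ E with hmdef
  have hr : 0 < r := hρ.trans_le hρr
  have hmR : (1 : ℝ) ≤ m := by exact_mod_cast hm
  have hR : 1 ≤ r / ρ := (one_le_div hρ).2 hρr
  set R := r / ρ with hRdef
  set b : ℝ := min (1 / R ^ 2) (m / (m + 1)) with hb
  have hb0 : 0 < b := lt_min (by positivity) (by positivity)
  have hb1 : b ≤ m / (m + 1) := min_le_right _ _
  have hbR : b ≤ 1 / R ^ 2 := min_le_left _ _
  have hbR' : 1 / R ^ 2 * (m / (m + 1)) ≤ b := by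
    refine le_min ?_ ?_
    · refine mul_le_of_le_one_right (by positivity) ?_
      rw [div_le_one (by positivity)]; linarith
    · refine mul_le_of_le_one_left (by positivity) ?_
      rw [div_le_one (by positivity)]; exact one_le_pow₀ hR
  set a : ℝ := 1 - b with ha
  have ha0 : 1 / ((m : ℝ) + 1) ≤ a := by
    have : 1 - (m : ℝ) / (m + 1) = 1 / (m + 1) := by field_simp; ring
    linarith
  have hapos : 0 < a := lt_of_lt_of_le (by positivity) ha0
  have ha1 : a < 1 := by linarith
  have h1a : 1 - a = b := by rw [ha]; ring
  have hρ1 : r * √(1 - a) ≤ ρ := by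
    rw [h1a]
    have : √b ≤ 1 / R := by
      rw [Real.sqrt_le_left (by positivity), one_div_pow]; exact hbR
    calc r * √b ≤ r * (1 / R) := by gcongr
      _ = ρ := by rw [hRdef]; field_simp
  have hinv : 1 / √b ≤ R * √(1 + (m : ℝ)⁻¹) := by
    rw [div_le_iff₀ (Real.sqrt_pos.2 hb0)]
    have h2 : 1 = R * √(1 + (m : ℝ)⁻¹) * √(1 / R ^ 2 * (m / (m + 1))) := by
      rw [Real.sqrt_mul (by positivity), Real.sqrt_div (by positivity), Real.sqrt_one,
        Real.sqrt_sq (by positivity)]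
      have h3 : √(1 + (m : ℝ)⁻¹) * √(m / (m + 1)) = 1 := by
        rw [← Real.sqrt_mul (by positivity), Real.sqrt_eq_one]; field_simp
      calc (1 : ℝ) = R * (1 / R) * (√(1 + (m : ℝ)⁻¹) * √(m / (m + 1))) := by
            rw [h3]; field_simp
        _ = _ := by ring
    calc (1 : ℝ) = _ := h2
      _ ≤ _ := by gcongr
  have hinv2 : (1 / √b) ^ m ≤ 2 * R ^ m := by
    have h4 : √(1 + (m : ℝ)⁻¹) ^ m ≤ 2 := by
      refine abs_le_of_sq_le_sq' ?_ (by norm_num) |>.2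
      rw [← pow_mul, mul_comm m, pow_mul, Real.sq_sqrt (by positivity)]
      linarith [one_add_inv_pow_le_three m]
    calc (1 / √b) ^ m ≤ (R * √(1 + (m : ℝ)⁻¹)) ^ m := by gcongr
      _ = √(1 + (m : ℝ)⁻¹) ^ m * R ^ m := by rw [mul_pow, mul_comm]
      _ ≤ 2 * R ^ m := by gcongr
  have hsqrt2 : √(1 + (m : ℝ)⁻¹) ≤ 2 := by
    rw [Real.sqrt_le_left (by norm_num)]
    have : (m : ℝ)⁻¹ ≤ 1 := inv_le_one_of_one_le₀ hmR
    linarith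
  set L := ⌈2 * ((m : ℝ) + 1) ^ 2 * R⌉₊ with hLdef
  have hL : ((m : ℝ) + 1) / (√a * √(1 - a)) ≤ L := by
    refine le_trans ?_ (Nat.le_ceil _)
    rw [h1a]
    have h5 : 1 / √a ≤ (m : ℝ) + 1 := by
      rw [div_le_iff₀ (Real.sqrt_pos.2 hapos)]
      have h6 : a ≤ √a := Real.le_sqrt_of_sq_le (by nlinarith)
      have h7 : 1 / ((m : ℝ) + 1) ≤ √a := ha0.trans h6
      rwa [div_le_iff₀' (by positivity)] at h7
    calc ((m : ℝ) + 1) / (√a * √b) = (m + 1) * (1 / √a) * (1 / √b) := by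
          field_simp
      _ ≤ (m + 1) * (m + 1) * (R * 2) := by
          gcongr
          exact hinv.trans (by gcongr)
      _ = _ := by ring
  have hLle : 2 * (L : ℝ) + 1 ≤ 7 * ((m : ℝ) + 1) ^ 2 * R := by
    have h8 := (Nat.ceil_lt_add_one (by positivity : 0 ≤ 2 * ((m : ℝ) + 1) ^ 2 * R)).le
    have h9 : 1 ≤ ((m : ℝ) + 1) ^ 2 * R := by
      refine one_le_mul_of_one_le_of_one_le (one_le_pow₀ (by linarith)) hR
    rw [← hLdef] at h8
    linarith
  set Q : ℝ := 42 * ((m : ℝ) + 1) ^ 2 * R * R ^ m with hQ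
  have hQ1 : 1 ≤ Q := by
    rw [hQ]
    have h9 : 1 ≤ ((m : ℝ) + 1) ^ 2 * R * R ^ m :=
      one_le_mul_of_one_le_of_one_le
        (one_le_mul_of_one_le_of_one_le (one_le_pow₀ (by linarith)) hR) (one_le_pow₀ hR)
    linarith
  obtain ⟨T, hT, hnet, hTcard⟩ := exists_net_closedBall (E := E) hr.le (by positivity : 0 < ρ * η)
  have hC0 : volume (Metric.closedBall (0 : E) (r * √a)) ≠ 0 :=
    (Metric.measure_closedBall_pos _ _ (by positivity)).ne'
  obtain ⟨F, hFcard, hF⟩ := exists_greedy_cover T hC0 measure_closedBall_lt_top.ne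
    (p := 1 / Q) (ρ := ρ) (by positivity) (by rw [div_le_one (by positivity)]; exact hQ1)
    (fun t ht => by
      have h10 := measureReal_closedBall_le_lens hm hapos ha1 hr (hT t ht) L hL
      rw [one_div_mul_eq_div, div_le_iff₀' (by positivity)]
      refine h10.trans ?_
      have h11 : 3 * (2 * (L : ℝ) + 1) * (1 / √(1 - a)) ^ m ≤ Q := by
        rw [h1a]
        calc 3 * (2 * (L : ℝ) + 1) * (1 / √b) ^ m
            ≤ 3 * (7 * ((m : ℝ) + 1) ^ 2 * R) * (2 * R ^ m) := by gcongr
          _ = Q := by rw [hQ]; ring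
      gcongr
      exact measure_ne_top_of_subset Set.inter_subset_left measure_closedBall_lt_top.ne)
  refine ⟨F, fun x hx => ?_, ?_⟩
  · obtain ⟨t, ht, hxt⟩ := hnet x hx
    obtain ⟨y, hy, hty⟩ := hF t ht
    exact ⟨y, hy, (dist_triangle _ t _).trans (by linarith)⟩
  · have hlogT : Real.log T.card ≤ m * (2 * R / η) := by
      rcases T.eq_empty_or_nonempty with hT0 | hTne
      · rw [hT0]; simp; positivity
      have h12 : (0 : ℝ) < T.card := by exact_mod_cast hTne.card_pos
      calc Real.log T.card ≤ Real.log ((1 + 2 * r / (ρ * η)) ^ m) := Real.log_le_log h12 hTcard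
        _ = m * Real.log (1 + 2 * r / (ρ * η)) := Real.log_pow _ _
        _ ≤ m * (2 * r / (ρ * η)) := by
          gcongr
          have := Real.log_le_sub_one_of_pos (by positivity : 0 < 1 + 2 * r / (ρ * η))
          linarith
        _ = _ := by rw [hRdef]; field_simp
    calc (F.card : ℝ) ≤ Real.log T.card / (1 / Q) + 1 := hFcard
      _ = Real.log T.card * Q + 1 := by rw [one_div, div_inv_eq_mul]
      _ ≤ (m + 1) * (2 * R / η) * Q + (m + 1) * (R / η) * Q := by
          refine add_le_add ?_ ?_
          · gcongr
            exact hlogT.trans (by gcongr; linarith)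
          · have : 1 ≤ R / η := by rw [one_le_div hη]; linarith
            exact one_le_mul_of_one_le_of_one_le
              (one_le_mul_of_one_le_of_one_le (by linarith) this) hQ1
      _ = 126 * (m + 1) ^ 3 * R ^ 2 / η * R ^ m := by rw [hQ]; ring

end EuclideanCovering

/-- Reverse water-filling: a distortion budget can be distributed over blocks so that the total cost
never exceeds the cost of the uniform energy profile. -/
lemma exists_water_filling {J : Type*} [Fintype J] {m t σ : J → ℝ} {τ : ℝ}
    (hm : ∀ j, 1 ≤ m j) (ht : ∀ j, 0 < t j) (hσ : ∀ j, 1 ≤ σ j)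
    (hsum : ∑ j, t j + τ ≤ 1) :
    ∃ z : J → ℝ, (∀ j, 0 < z j ∧ z j ≤ t j * σ j ∧ t j ≤ z j * ∑ i, m i) ∧
      ∑ j, z j + τ ≤ 1 ∧
      ∑ j, m j * Real.log (t j * σ j / z j) ≤ ∑ j, m j * Real.log (σ j) := by
  have hm0 : ∀ j, 0 < m j := fun j => one_pos.trans_le (hm j)
  have hσ0 : ∀ j, 0 < σ j := fun j => one_pos.trans_le (hσ j)
  have htσ : ∀ j, 0 < t j * σ j := fun j => mul_pos (ht j) (hσ0 j)
  have hmle : ∀ j, m j ≤ ∑ i, m i := fun j =>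
    Finset.single_le_sum (fun i _ => (hm0 i).le) (Finset.mem_univ j)
  have htle : ∀ j, t j ≤ 1 - τ := fun j => by
    have := Finset.single_le_sum (fun i _ => (ht i).le) (Finset.mem_univ j)
    linarith
  by_cases hA : ∑ j, t j * σ j + τ ≤ 1
  · refine ⟨fun j => t j * σ j, fun j => ⟨htσ j, le_rfl, ?_⟩, hA, ?_⟩
    · have h1 : 1 ≤ σ j * ∑ i, m i :=
        one_le_mul_of_one_le_of_one_le (hσ j) ((hm j).trans (hmle j))
      nlinarith [ht j]
    · refine Finset.sum_le_sum fun j _ => ?_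
      rw [div_self (htσ j).ne', Real.log_one, mul_zero]
      exact mul_nonneg (hm0 j).le (Real.log_nonneg (hσ j))
  push Not at hA
  set φ₁ := ∑ j, t j * σ j / m j with hφ₁
  have hφ₁0 : 0 ≤ φ₁ := Finset.sum_nonneg fun j _ => (div_pos (htσ j) (hm0 j)).le
  have hcont : ContinuousOn (fun φ : ℝ => ∑ j, min (m j * φ) (t j * σ j)) (Set.Icc 0 φ₁) := by
    fun_prop
  have htsum : 0 ≤ ∑ j, t j := Finset.sum_nonneg fun j _ => (ht j).le
  obtain ⟨φ, ⟨hφ0, -⟩, hφ⟩ := intermediate_value_Icc hφ₁0 hcont (show 1 - τ ∈ Set.Icc _ _ from by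
    constructor
    · simp only [mul_zero]
      rw [Finset.sum_congr rfl fun j _ => min_eq_left (htσ j).le]
      simp; linarith
    · have : ∀ j, min (m j * φ₁) (t j * σ j) = t j * σ j := fun j => by
        refine min_eq_right ?_
        rw [← div_le_iff₀' (hm0 j)]
        exact Finset.single_le_sum (f := fun j => t j * σ j / m j)
          (fun i _ => (div_pos (htσ i) (hm0 i)).le) (Finset.mem_univ j)
      simp only [this]; linarith)
  simp only at hφ
  have hne : Nonempty J := by
    by_contra hJ
    rw [not_nonempty_iff] at hJ
    simp at hA hsum
    linarith
  have hφpos : 0 < φ := by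
    rcases hφ0.eq_or_lt with h | h
    · exfalso
      rw [← h] at hφ
      simp only [mul_zero] at hφ
      rw [Finset.sum_congr rfl fun j _ => min_eq_left (htσ j).le] at hφ
      have := htle hne.some
      have := ht hne.some
      simp at hφ; linarith
    · exact h
  have hφm : 1 - τ ≤ φ * ∑ i, m i := by
    rw [← hφ, Finset.mul_sum]
    exact Finset.sum_le_sum fun j _ => (min_le_left _ _).trans (by rw [mul_comm])
  set z : J → ℝ := fun j => min (m j * φ) (t j * σ j) with hz
  have hz0 : ∀ j, 0 < z j := fun j => lt_min (mul_pos (hm0 j) hφpos) (htσ j)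
  refine ⟨z, fun j => ⟨hz0 j, min_le_right _ _, ?_⟩, by rw [hφ]; linarith, ?_⟩
  · rcases min_choice (m j * φ) (t j * σ j) with h | h
    · simp only [hz, h]
      have h1 : 1 - τ ≤ m j * (φ * ∑ i, m i) :=
        hφm.trans (le_mul_of_one_le_left ((ht j).le.trans ((htle j).trans hφm)) (hm j))
      linarith [htle j]
    · simp only [hz, h]
      have h1 : 1 ≤ σ j * ∑ i, m i :=
        one_le_mul_of_one_le_of_one_le (hσ j) ((hm j).trans (hmle j))
      nlinarith [ht j]
  · have hterm : ∀ j, m j * Real.log (t j * σ j / z j) ≤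
        m j * Real.log (σ j) + (t j - z j) / φ := by
      intro j
      rcases le_total (m j * φ) (t j * σ j) with h | h
      · have hzj : z j = m j * φ := min_eq_left h
        have h2 : t j * σ j / z j = σ j * (t j / z j) := by ring
        have h3 := Real.log_le_sub_one_of_pos (div_pos (ht j) (hz0 j))
        rw [h2, Real.log_mul (hσ0 j).ne' (div_pos (ht j) (hz0 j)).ne', mul_add]
        have h4 : (t j - z j) / φ = m j * (t j / z j - 1) := by
          rw [hzj]; have := hm0 j; field_simp
        rw [h4]
        gcongr
        exact (hm0 j).le
      · have hzj : z j = t j * σ j := min_eq_right h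
        rw [hzj, div_self (htσ j).ne', Real.log_one, mul_zero]
        have h5 := Real.one_sub_inv_le_log_of_pos (hσ0 j)
        have h6 : (t j - t j * σ j) / φ = - (t j * σ j / φ * (1 - (σ j)⁻¹)) := by
          have := hσ0 j
          field_simp; ring
        have h7 : t j * σ j / φ ≤ m j := by rwa [div_le_iff₀ hφpos]
        have h8 : 0 ≤ 1 - (σ j)⁻¹ := sub_nonneg.2 (inv_le_one_of_one_le₀ (hσ j))
        rw [h6]
        have := hm0 j
        nlinarith [mul_le_mul_of_nonneg_right h7 h8, mul_le_mul_of_nonneg_left h5 (hm0 j).le]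
    calc _ ≤ ∑ j, (m j * Real.log (σ j) + (t j - z j) / φ) :=
          Finset.sum_le_sum fun j _ => hterm j
      _ = ∑ j, m j * Real.log (σ j) + (∑ j, t j - ∑ j, z j) / φ := by
          rw [Finset.sum_add_distrib, ← Finset.sum_div, Finset.sum_sub_distrib]
      _ ≤ _ := by
          have : (∑ j, t j - ∑ j, z j) / φ ≤ 0 :=
            div_nonpos_of_nonpos_of_nonneg (by rw [hφ]; linarith) hφpos.le
          linarith

lemma lp_two_summable_sq (x : lp (fun _ : ℕ => ℝ) 2) : Summable fun n => (x n) ^ 2 := by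
  have h := (lp.memℓp x).summable (by norm_num)
  simpa using h

lemma lp_two_norm_sq (x : lp (fun _ : ℕ => ℝ) 2) : ‖x‖ ^ 2 = ∑' n, (x n) ^ 2 := by
  have h := lp.norm_rpow_eq_tsum (p := 2) (by norm_num) x
  simpa using h

/-- The finitely supported element of `ℓ²` with prescribed coordinates on `S`. -/
def lpOfFinset (S : Finset ℕ) (f : S → ℝ) : lp (fun _ : ℕ => ℝ) 2 :=
  ⟨fun n => if h : n ∈ S then f ⟨n, h⟩ else 0, by
    refine memℓp_gen (summable_of_hasFiniteSupport (S.finite_toSet.subset fun n hn => ?_))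
    by_contra h
    exact hn (by simp [show n ∉ S from h])⟩

lemma lpOfFinset_apply_mem {S : Finset ℕ} (f : S → ℝ) (n : S) : lpOfFinset S f n = f n := by
  simp [lpOfFinset]

lemma lpOfFinset_apply_notMem {S : Finset ℕ} (f : S → ℝ) {n : ℕ} (h : n ∉ S) :
    lpOfFinset S f n = 0 := by
  simp [lpOfFinset, h]

lemma dist_lpOfFinset_sq (S : Finset ℕ) (f : S → ℝ) (x : lp (fun _ : ℕ => ℝ) 2) :
    dist x (lpOfFinset S f) ^ 2 =
      ∑ n : S, (x n - f n) ^ 2 + ∑' n : ↑((S : Set ℕ)ᶜ), (x n) ^ 2 := by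
  rw [dist_eq_norm, lp_two_norm_sq,
    ← (lp_two_summable_sq (x - lpOfFinset S f)).sum_add_tsum_compl (s := S)]
  congr 1
  · rw [← Finset.sum_coe_sort]
    refine Finset.sum_congr rfl fun n _ => ?_
    rw [lp.coeFn_sub, Pi.sub_apply, lpOfFinset_apply_mem]
  · refine tsum_congr fun n => ?_
    have hn : (n : ℕ) ∉ S := fun h => n.2 (Finset.mem_coe.2 h)
    rw [lp.coeFn_sub, Pi.sub_apply, lpOfFinset_apply_notMem f hn, sub_zero]

section Blocks

variable {S : Finset ℕ} {J : Type*} [Fintype J] [DecidableEq J]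

/-- Covering of all points of `ℓ²` whose energy profile along a block decomposition is dominated by
a given one. -/
lemma exists_cover_of_profile (lev : S → J) (hlev : Function.Surjective lev)
    {M t : J → ℝ} {τ e A η Λ : ℝ} {D : ℕ} (he : 0 < e) (hη : 0 < η) (hη1 : η ≤ 1) (hΛ : 0 < Λ)
    (hMe : ∀ j, e ≤ M j) (hMA : ∀ j, M j ≤ A * e) (hD : S.card ≤ D)
    (ht : ∀ j, 0 < t j) (hτ : 0 ≤ τ) (hsum : ∑ j, t j + τ ≤ 1) :
    ∃ F : Finset (lp (fun _ : ℕ => ℝ) 2),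
      (F.card : ℝ) ≤ (126 * ((D : ℝ) + 1) ^ 4 * A ^ 2 / η) ^ Fintype.card J *
        ∏ n : S, (M (lev n) / e) ∧
      ∀ x : lp (fun _ : ℕ => ℝ) 2,
        (∀ j, ∑ n : {n : S // lev n = j}, (x n) ^ 2 ≤ M j ^ 2 * Λ ^ 2 * t j) →
        ∑' n : ↑((S : Set ℕ)ᶜ), (x n) ^ 2 ≤ e ^ 2 * Λ ^ 2 * τ →
        ∃ y ∈ F, dist x y ≤ e * Λ * (1 + η) := by
  classical
  set d : J → ℕ := fun j => Fintype.card {n : S // lev n = j} with hd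
  have hd1 : ∀ j, 1 ≤ d j := fun j => by
    obtain ⟨n, hn⟩ := hlev j
    exact Fintype.card_pos_iff.2 ⟨⟨n, hn⟩⟩
  have hdsum : ∑ j, (d j : ℝ) = S.card := by
    have h := Fintype.sum_fiberwise lev (fun _ : S => (1 : ℝ))
    simpa [hd] using h
  have hdD : ∀ j, (d j : ℝ) ≤ D := fun j => by
    have h1 : (d j : ℝ) ≤ ∑ i, (d i : ℝ) :=
      Finset.single_le_sum (f := fun i => (d i : ℝ)) (fun i _ => Nat.cast_nonneg _)
        (Finset.mem_univ j)
    rw [hdsum] at h1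
    exact h1.trans (by exact_mod_cast hD)
  have hM0 : ∀ j, 0 < M j := fun j => he.trans_le (hMe j)
  set σ : J → ℝ := fun j => (M j / e) ^ 2 with hσ
  have hMe1 : ∀ j, 1 ≤ M j / e := fun j => (one_le_div he).2 (hMe j)
  have hσ1 : ∀ j, 1 ≤ σ j := fun j => one_le_pow₀ (hMe1 j)
  obtain ⟨z, hz, hzsum, hzlog⟩ := exists_water_filling (m := fun j => (d j : ℝ)) (t := t) (σ := σ)
    (τ := τ) (fun j => by exact_mod_cast hd1 j) ht hσ1 hsum
  set r : J → ℝ := fun j => M j * Λ * √(t j) with hr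
  set ρ : J → ℝ := fun j => e * Λ * √(z j) with hρ
  have hρ0 : ∀ j, 0 < ρ j := fun j => by have := Real.sqrt_pos.2 (hz j).1; positivity
  have hr0 : ∀ j, 0 < r j := fun j => by
    have := Real.sqrt_pos.2 (ht j); have := hM0 j; positivity
  have hratio : ∀ j, (r j / ρ j) ^ 2 = t j * σ j / z j := fun j => by
    simp only [hr, hρ, hσ, div_pow, mul_pow, Real.sq_sqrt (ht j).le, Real.sq_sqrt (hz j).1.le]
    have := (hz j).1
    field_simp
  have hρr : ∀ j, ρ j ≤ r j := fun j => by
    rw [← one_le_div (hρ0 j)]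
    refine abs_le_of_sq_le_sq' (a := 1) ?_ (div_pos (hr0 j) (hρ0 j)).le |>.2
    rw [hratio, one_pow, one_le_div (hz j).1]
    exact (hz j).2.1
  have hA : ∀ j, 1 ≤ A := fun j => by
    have := (hMe j).trans (hMA j)
    nlinarith
  have hratioA : ∀ j, (r j / ρ j) ^ 2 ≤ A ^ 2 * D := fun j => by
    rw [hratio, div_le_iff₀ (hz j).1]
    have h1 : σ j ≤ A ^ 2 := by
      have := hMe1 j
      simp only [hσ]; gcongr; rw [div_le_iff₀ he]; exact hMA j
    have h2 : t j ≤ z j * D := by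
      refine (hz j).2.2.trans ?_
      rw [hdsum]
      have := (hz j).1
      gcongr
    have h3 := (hz j).1
    have h4 := ht j
    calc t j * σ j ≤ (z j * D) * A ^ 2 := by gcongr
      _ = _ := by ring
  have hcov : ∀ j, ∃ F : Finset (EuclideanSpace ℝ {n : S // lev n = j}),
      (∀ x, ‖x‖ ≤ r j → ∃ y ∈ F, dist x y ≤ ρ j * (1 + η)) ∧
      (F.card : ℝ) ≤ 126 * ((D : ℝ) + 1) ^ 4 * A ^ 2 / η * (r j / ρ j) ^ d j := fun j => by
    obtain ⟨F, hF, hcard⟩ := exists_cover_closedBall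
      (E := EuclideanSpace ℝ {n : S // lev n = j}) (by rw [finrank_euclideanSpace]; exact hd1 j)
      (hρ0 j) (hρr j) hη hη1
    refine ⟨F, hF, hcard.trans ?_⟩
    rw [finrank_euclideanSpace]
    have := (div_pos (hr0 j) (hρ0 j)).le
    gcongr ?_ / _ * (_ : ℝ) ^ d j
    calc 126 * ((d j : ℝ) + 1) ^ 3 * (r j / ρ j) ^ 2
        ≤ 126 * ((D : ℝ) + 1) ^ 3 * (A ^ 2 * D) := by
          gcongr
          · exact_mod_cast hdD j
          · exact hratioA j
      _ ≤ 126 * ((D : ℝ) + 1) ^ 3 * (A ^ 2 * (D + 1)) := by gcongr; linarith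
      _ = _ := by ring
  choose F hF hcard using hcov
  set Φ : (∀ j, EuclideanSpace ℝ {n : S // lev n = j}) → lp (fun _ : ℕ => ℝ) 2 :=
    fun f => lpOfFinset S fun n => f (lev n) ⟨n, rfl⟩ with hΦ
  refine ⟨(Fintype.piFinset F).image Φ, ?_, fun x hx hxτ => ?_⟩
  · have hprod : ∏ j, (r j / ρ j) ^ d j ≤ ∏ n : S, (M (lev n) / e) := by
      have h1 : ∏ n : S, (M (lev n) / e) = ∏ j, (M j / e) ^ d j := by
        rw [← Fintype.prod_fiberwise lev]
        refine Finset.prod_congr rfl fun j _ => ?_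
        rw [Finset.prod_congr rfl (g := fun _ => M j / e) fun n _ => by rw [n.2]]
        rw [Finset.prod_const, Finset.card_univ]
      rw [h1]
      have h2 : ∀ j, 0 < (r j / ρ j) ^ d j := fun j => pow_pos (div_pos (hr0 j) (hρ0 j)) _
      have h3 : ∀ j, 0 < (M j / e) ^ d j := fun j => pow_pos (div_pos (hM0 j) he) _
      rw [← Real.log_le_log_iff (Finset.prod_pos fun j _ => h2 j) (Finset.prod_pos fun j _ => h3 j),
        Real.log_prod fun j _ => (h2 j).ne', Real.log_prod fun j _ => (h3 j).ne']
      simp only [← hratio] at hzlog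
      simp only [hσ, Real.log_pow] at hzlog
      simp only [Real.log_pow]
      have h4 : ∀ a : J → ℝ, ∑ j, (d j : ℝ) * (((2 : ℕ) : ℝ) * a j) = 2 * ∑ j, (d j : ℝ) * a j := by
        intro a
        rw [Finset.mul_sum]
        exact Finset.sum_congr rfl fun j _ => by push_cast; ring
      rw [h4, h4] at hzlog
      linarith
    calc (((Fintype.piFinset F).image Φ).card : ℝ) ≤ ((Fintype.piFinset F).card : ℝ) := by
          exact_mod_cast Finset.card_image_le
      _ = ∏ j, ((F j).card : ℝ) := by rw [Fintype.card_piFinset]; push_cast; rfl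
      _ ≤ ∏ j, (126 * ((D : ℝ) + 1) ^ 4 * A ^ 2 / η * (r j / ρ j) ^ d j) :=
          Finset.prod_le_prod (fun _ _ => Nat.cast_nonneg _) fun j _ => hcard j
      _ = (126 * ((D : ℝ) + 1) ^ 4 * A ^ 2 / η) ^ Fintype.card J * ∏ j, (r j / ρ j) ^ d j := by
          rw [Finset.prod_mul_distrib, Finset.prod_const, Finset.card_univ]
      _ ≤ _ := by gcongr
  · set X : ∀ j, EuclideanSpace ℝ {n : S // lev n = j} := fun j => WithLp.toLp 2 fun n => x n with hX
    have hXnorm : ∀ j, ‖X j‖ ≤ r j := fun j => by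
      refine abs_le_of_sq_le_sq' ?_ (hr0 j).le |>.2
      rw [EuclideanSpace.norm_sq_eq]
      simp only [hX, hr, mul_pow, Real.sq_sqrt (ht j).le, Real.norm_eq_abs, sq_abs]
      exact hx j
    choose y hy hdist using fun j => hF j (X j) (hXnorm j)
    refine ⟨Φ y, Finset.mem_image_of_mem _ (Fintype.mem_piFinset.2 hy), ?_⟩
    refine abs_le_of_sq_le_sq' ?_ (by positivity) |>.2
    rw [dist_lpOfFinset_sq, ← Fintype.sum_fiberwise lev]
    have hblock : ∀ j, ∑ n : {n : S // lev n = j},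
        (x n - y (lev n) ⟨n, rfl⟩) ^ 2 ≤ (e * Λ * (1 + η)) ^ 2 * z j := fun j => by
      have h1 : ∑ n : {n : S // lev n = j}, (x n - y (lev n) ⟨n, rfl⟩) ^ 2 = dist (X j) (y j) ^ 2 := by
        rw [EuclideanSpace.dist_eq, Real.sq_sqrt (Finset.sum_nonneg fun _ _ => sq_nonneg _)]
        refine Finset.sum_congr rfl ?_
        rintro ⟨n, rfl⟩ _
        simp [hX, Real.dist_eq, sq_abs]
      rw [h1]
      calc dist (X j) (y j) ^ 2 ≤ (ρ j * (1 + η)) ^ 2 := by gcongr; exact hdist j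
        _ = (e * Λ * (1 + η)) ^ 2 * z j := by
          simp only [hρ, mul_pow, Real.sq_sqrt (hz j).1.le]; ring
    calc _ ≤ ∑ j, (e * Λ * (1 + η)) ^ 2 * z j + e ^ 2 * Λ ^ 2 * τ :=
          add_le_add (Finset.sum_le_sum fun j _ => hblock j) hxτ
      _ ≤ (e * Λ * (1 + η)) ^ 2 * ∑ j, z j + (e * Λ * (1 + η)) ^ 2 * τ := by
          rw [← Finset.mul_sum]
          gcongr
          rw [mul_pow, mul_pow]
          exact le_mul_of_one_le_right (by positivity) (one_le_pow₀ (by linarith))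
      _ = (e * Λ * (1 + η)) ^ 2 * (∑ j, z j + τ) := by ring
      _ ≤ _ := mul_le_of_le_one_right (by positivity) hzsum

end Blocks

lemma ellipsoid_block_energy_le_one {μ : ℕ → ℝ} {S : Finset ℕ} {J : Type*} [Fintype J]
    [DecidableEq J] (lev : S → J) {x : lp (fun _ : ℕ => ℝ) 2} (hx : x ∈ ellipsoid μ) :
    ∑ j, ∑ n : {n : S // lev n = j}, (x n / μ n) ^ 2 +
      ∑' n : ↑((S : Set ℕ)ᶜ), (x n / μ n) ^ 2 ≤ 1 := by
  rw [Fintype.sum_fiberwise lev (fun n : S => (x n / μ n) ^ 2),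
    Finset.sum_coe_sort S (fun n => (x n / μ n) ^ 2), hx.1.sum_add_tsum_compl (s := S)]
  exact hx.2

/-- Covering of an ellipsoid whose leading semi-axes are grouped into blocks. -/
lemma exists_cover_ellipsoid {μ : ℕ → ℝ} (hμ : ∀ n, 0 < μ n) {S : Finset ℕ} {J : Type*} [Fintype J]
    [DecidableEq J] (lev : S → J) (hlev : Function.Surjective lev)
    {M : J → ℝ} {e A η : ℝ} {D G : ℕ} (he : 0 < e) (hη : 0 < η) (hη1 : η ≤ 1) (hG : 0 < G)
    (hMe : ∀ j, e ≤ M j) (hMA : ∀ j, M j ≤ A * e) (hD : S.card ≤ D)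
    (hμM : ∀ n : S, μ n ≤ M (lev n)) (htail : ∀ n ∉ S, μ n ≤ e) :
    ∃ F : Finset (lp (fun _ : ℕ => ℝ) 2),
      (F.card : ℝ) ≤ ((G : ℝ) + 1) ^ (Fintype.card J + 1) *
        ((126 * ((D : ℝ) + 1) ^ 4 * A ^ 2 / η) ^ Fintype.card J * ∏ n : S, (M (lev n) / e)) ∧
      ∀ x ∈ ellipsoid μ, ∃ y ∈ F,
        dist x y ≤ e * √(((G : ℝ) + Fintype.card J + 1) / G) * (1 + η) := by
  classical
  set K := Fintype.card J with hK
  set G' : ℝ := (G : ℝ) + K + 1 with hG'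
  have hG0 : (0 : ℝ) < G := by exact_mod_cast hG
  have hG'0 : 0 < G' := by positivity
  set Q : ℝ := (126 * ((D : ℝ) + 1) ^ 4 * A ^ 2 / η) ^ K * ∏ n : S, (M (lev n) / e) with hQ
  have hQ0 : 0 ≤ Q := mul_nonneg (by positivity)
    (Finset.prod_nonneg fun n _ => div_nonneg (he.le.trans (hMe _)) he.le)
  set Λ : ℝ := √(G' / G) with hΛ
  have hΛsq : Λ ^ 2 = G' / G := Real.sq_sqrt (by positivity)
  have hΛ0 : 0 < Λ := Real.sqrt_pos.2 (by positivity)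
  have key : ∀ k : Option J → Fin (G + 1), ∃ F : Finset (lp (fun _ : ℕ => ℝ) 2),
      (F.card : ℝ) ≤ Q ∧ (∑ i, ((k i : ℝ) + 1) ≤ G' → ∀ x : lp (fun _ : ℕ => ℝ) 2,
        (∀ j, ∑ n : {n : S // lev n = j}, (x n) ^ 2 ≤
          M j ^ 2 * Λ ^ 2 * (((k (some j) : ℝ) + 1) / G')) →
        ∑' n : ↑((S : Set ℕ)ᶜ), (x n) ^ 2 ≤ e ^ 2 * Λ ^ 2 * (((k none : ℝ) + 1) / G') →
        ∃ y ∈ F, dist x y ≤ e * Λ * (1 + η)) := fun k => by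
    by_cases hk : ∑ i, ((k i : ℝ) + 1) ≤ G'
    · obtain ⟨F, hF, hF'⟩ := exists_cover_of_profile lev hlev (M := M) (Λ := Λ)
        (t := fun j => ((k (some j) : ℝ) + 1) / G') (τ := ((k none : ℝ) + 1) / G') he hη hη1 hΛ0
        hMe hMA hD (fun j => by positivity) (by positivity) (by
          rw [← Finset.sum_div, ← add_div, div_le_one hG'0, add_comm]
          rwa [Fintype.sum_option] at hk)
      exact ⟨F, hF, fun _ => hF'⟩
    · exact ⟨∅, by simpa using hQ0, fun h => absurd h hk⟩
  choose F hF hF' using key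
  refine ⟨Finset.univ.biUnion F, ?_, fun x hx => ?_⟩
  · calc ((Finset.univ.biUnion F).card : ℝ) ≤ ∑ k, ((F k).card : ℝ) := by
          exact_mod_cast Finset.card_biUnion_le
      _ ≤ ∑ k : Option J → Fin (G + 1), Q := Finset.sum_le_sum fun k _ => hF k
      _ = _ := by simp [hK]
  · set v : Option J → ℝ := fun i => i.elim (∑' n : ↑((S : Set ℕ)ᶜ), (x n / μ n) ^ 2)
      (fun j => ∑ n : {n : S // lev n = j}, (x n / μ n) ^ 2) with hv
    have hvsum : ∑ i, v i ≤ 1 := by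
      rw [Fintype.sum_option, add_comm]
      exact ellipsoid_block_energy_le_one lev hx
    have hv0 : ∀ i, 0 ≤ v i := by
      rintro (_ | j)
      · exact tsum_nonneg fun _ => sq_nonneg _
      · exact Finset.sum_nonneg fun _ _ => sq_nonneg _
    have hv1 : ∀ i, v i ≤ 1 := fun i =>
      (Finset.single_le_sum (fun i _ => hv0 i) (Finset.mem_univ i)).trans hvsum
    set k : Option J → Fin (G + 1) := fun i => ⟨⌊G * v i⌋₊, by
      refine Nat.lt_succ_of_le (Nat.floor_le_of_le ?_)
      exact mul_le_of_le_one_right hG0.le (hv1 i)⟩ with hk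
    have hkle : ∀ i, (k i : ℝ) ≤ G * v i := fun i =>
      Nat.floor_le (mul_nonneg hG0.le (hv0 i))
    have hklt : ∀ i, G * v i ≤ (k i : ℝ) + 1 := fun i => (Nat.lt_floor_add_one _).le
    have hbound : ∀ i, v i ≤ Λ ^ 2 * (((k i : ℝ) + 1) / G') := fun i => by
      rw [hΛsq, div_mul_div_comm, mul_comm G', mul_div_mul_right _ _ hG'0.ne', le_div_iff₀ hG0,
        mul_comm]
      exact hklt i
    obtain ⟨y, hy, hxy⟩ := hF' k (by
      calc ∑ i, ((k i : ℝ) + 1) ≤ ∑ i, (G * v i + 1) :=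
            Finset.sum_le_sum fun i _ => by linarith [hkle i]
        _ = G * ∑ i, v i + (K + 1) := by
            rw [Finset.sum_add_distrib, ← Finset.mul_sum]; simp [hK]
        _ ≤ G' := by nlinarith) x (fun j => by
      rw [mul_assoc]
      refine le_trans ?_ (mul_le_mul_of_nonneg_left (hbound (some j)) (sq_nonneg _))
      simp only [hv, Option.elim, Finset.mul_sum]
      refine Finset.sum_le_sum ?_
      rintro ⟨n, rfl⟩ _
      rw [← mul_pow]
      have h1 := hμ n
      have h2 := hμM n
      have h3 : x n ^ 2 = (μ n) ^ 2 * (x n / μ n) ^ 2 := by field_simp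
      rw [h3, mul_pow]
      gcongr) (by
      rw [mul_assoc]
      refine le_trans ?_ (mul_le_mul_of_nonneg_left (hbound none) (sq_nonneg _))
      simp only [hv, Option.elim, ← tsum_mul_left]
      refine Summable.tsum_le_tsum (fun n => ?_) ((lp_two_summable_sq x).subtype _)
        ((hx.1.subtype _).mul_left _)
      have h1 := hμ n
      have h2 := htail n fun h => n.2 (Finset.mem_coe.2 h)
      have h3 : x n ^ 2 = (μ n) ^ 2 * (x n / μ n) ^ 2 := by field_simp
      rw [h3]
      gcongr)
    exact ⟨y, Finset.mem_biUnion.2 ⟨k, Finset.mem_univ _, hy⟩, hxy⟩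

/-- Upper bound for the covering numbers of an ellipsoid in terms of the semi-axes above a given
threshold. -/
lemma exists_cover_ellipsoid_exp {μ : ℕ → ℝ} (hμ : ∀ n, 0 < μ n) {S : Finset ℕ} {e R : ℝ} {D : ℕ}
    (he : 0 < e) (hS : ∀ n, n ∈ S ↔ e < μ n) (hD : S.card ≤ D) (hD0 : 0 < D) (hR : 0 ≤ R)
    (hSR : ∀ n ∈ S, Real.log (μ n / e) ≤ R) :
    ∃ F : Finset (lp (fun _ : ℕ => ℝ) 2),
      (∀ x ∈ ellipsoid μ, ∃ y ∈ F, dist x y ≤ e * Real.exp (2 / D)) ∧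
      Real.log F.card ≤ ∑ n ∈ S, Real.log (μ n / e) + √D +
        (R * √D + 2) * (8 + 7 * Real.log (D + 1) + 3 * R) := by
  classical
  have hD1 : (1 : ℝ) ≤ D := by exact_mod_cast hD0
  have hsD1 : 1 ≤ √(D : ℝ) := Real.one_le_sqrt.2 hD1
  have hsq : √(D : ℝ) ^ 2 = D := Real.sq_sqrt (by positivity)
  set δ : ℝ := (√(D : ℝ))⁻¹ with hδ
  have hδ0 : 0 < δ := by positivity
  have hδ1 : δ ≤ 1 := inv_le_one_of_one_le₀ hsD1
  set p : ℕ → ℝ := fun n => Real.log (μ n / e) with hp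
  have hp0 : ∀ n ∈ S, 0 ≤ p n := fun n hn =>
    Real.log_nonneg ((one_le_div he).2 ((hS n).1 hn).le)
  set J : Finset ℕ := S.image fun n => ⌊p n / δ⌋₊ with hJ
  set lev : S → J := fun n => ⟨⌊p n / δ⌋₊, Finset.mem_image_of_mem _ n.2⟩ with hlev
  have hsurj : Function.Surjective lev := by
    rintro ⟨j, hj⟩
    obtain ⟨n, hn, rfl⟩ := Finset.mem_image.1 hj
    exact ⟨⟨n, hn⟩, rfl⟩
  set M : J → ℝ := fun j => e * Real.exp (((j : ℕ) + 1) * δ) with hM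
  set A : ℝ := Real.exp (R + δ) with hA
  set K := Fintype.card J with hK
  have hKR : (K : ℝ) + 1 ≤ R * √D + 2 := by
    have h1 : K ≤ ⌊R / δ⌋₊ + 1 := by
      rw [hK, Fintype.card_coe, ← Finset.card_range (⌊R / δ⌋₊ + 1)]
      refine Finset.card_le_card fun j hj => ?_
      obtain ⟨n, hn, rfl⟩ := Finset.mem_image.1 hj
      rw [Finset.mem_range, Nat.lt_succ_iff]
      exact Nat.floor_le_floor (div_le_div_of_nonneg_right (hSR n hn) hδ0.le)
    have h2 : (K : ℝ) ≤ ⌊R / δ⌋₊ + 1 := by exact_mod_cast h1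
    have h3 := Nat.floor_le (div_nonneg hR hδ0.le)
    have h4 : R / δ = R * √D := by rw [hδ, div_inv_eq_mul]
    linarith
  have hpδ : ∀ n : S, ((lev n : ℕ) : ℝ) * δ ≤ p n ∧ p n ≤ ((lev n : ℕ) + 1) * δ := fun n =>
    ⟨by rw [← le_div_iff₀ hδ0]; exact Nat.floor_le (div_nonneg (hp0 n n.2) hδ0.le),
     by rw [← div_le_iff₀ hδ0]; exact (Nat.lt_floor_add_one _).le⟩
  obtain ⟨F, hcard, hF⟩ := exists_cover_ellipsoid hμ lev hsurj (M := M) (e := e) (A := A)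
    (η := (D : ℝ)⁻¹) (D := D) (G := D * (K + 1)) he (by positivity) (inv_le_one_of_one_le₀ hD1)
    (by positivity) (fun j => le_mul_of_one_le_right he.le (Real.one_le_exp (by positivity)))
    (fun j => by
      obtain ⟨n, rfl⟩ := hsurj j
      simp only [hM, hA]
      rw [mul_comm]
      gcongr
      have := (hpδ n).1
      have := hSR n n.2
      simp only [hp] at *
      linarith) hD
    (fun n => by
      have h1 := (hpδ n).2
      have h2 : μ n = e * Real.exp (p n) := by
        simp only [hp]
        rw [Real.exp_log (div_pos (hμ n) he)]; field_simp
      rw [h2]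
      simp only [hM]
      gcongr)
    (fun n hn => by
      rw [hS] at hn
      exact not_lt.1 hn)
  refine ⟨F, fun x hx => ?_, ?_⟩
  · obtain ⟨y, hy, hxy⟩ := hF x hx
    refine ⟨y, hy, hxy.trans ?_⟩
    have h1 : ((D * (K + 1) : ℕ) + (K : ℝ) + 1) / (D * (K + 1) : ℕ) = 1 + (D : ℝ)⁻¹ := by
      push_cast
      field_simp
      ring
    rw [h1, mul_assoc]
    have h2 : 1 + (D : ℝ)⁻¹ ≤ Real.exp ((D : ℝ)⁻¹) := by
      rw [add_comm]; exact Real.add_one_le_exp _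
    have h3 : √(1 + (D : ℝ)⁻¹) ≤ 1 + (D : ℝ)⁻¹ := by
      rw [Real.sqrt_le_left (by positivity)]
      nlinarith [inv_pos.2 (zero_lt_one.trans_le hD1)]
    have h4 : Real.exp (2 / D) = Real.exp ((D : ℝ)⁻¹) * Real.exp ((D : ℝ)⁻¹) := by
      rw [← Real.exp_add]; congr 1; ring
    rw [h4]
    gcongr
    exact h3.trans h2
  · have hL : 0 ≤ Real.log ((D : ℝ) + 1) := Real.log_nonneg (by linarith)
    have hI : 0 ≤ ∑ n ∈ S, p n := Finset.sum_nonneg hp0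
    rcases Nat.eq_zero_or_pos F.card with h0 | h0
    · rw [h0, Nat.cast_zero, Real.log_zero]
      positivity
    have hP : 1 ≤ 126 * ((D : ℝ) + 1) ^ 4 * A ^ 2 / (D : ℝ)⁻¹ := by
      have hA1 : 1 ≤ A := Real.one_le_exp (by positivity)
      rw [div_inv_eq_mul]
      have h5 : 1 ≤ ((D : ℝ) + 1) ^ 4 := one_le_pow₀ (by linarith)
      have h6 : 1 ≤ A ^ 2 := one_le_pow₀ hA1
      calc (1 : ℝ) = 1 * 1 * 1 * 1 := by norm_num
        _ ≤ _ := by gcongr; norm_num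
    set P : ℝ := 126 * ((D : ℝ) + 1) ^ 4 * A ^ 2 / (D : ℝ)⁻¹ with hPdef
    have hprod : Real.log (∏ n : S, (M (lev n) / e)) ≤ ∑ n ∈ S, p n + √D := by
      have h7 : ∀ n : S, M (lev n) / e = Real.exp (((lev n : ℕ) + 1) * δ) := fun n => by
        simp only [hM]; field_simp
      rw [Finset.prod_congr rfl fun n _ => h7 n, ← Real.exp_sum, Real.log_exp,
        ← Finset.sum_coe_sort S p]
      calc ∑ n : S, (((lev n : ℕ) : ℝ) + 1) * δ ≤ ∑ n : S, (p n + δ) :=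
            Finset.sum_le_sum fun n _ => by linarith [(hpδ n).1]
        _ = ∑ n : S, p n + S.card * δ := by
            rw [Finset.sum_add_distrib]; simp
        _ ≤ ∑ n : S, p n + D * δ := by gcongr
        _ = _ := by
            congr 1
            rw [hδ, ← div_eq_mul_inv, Real.div_sqrt]
    have hprod0 : 0 < ∏ n : S, (M (lev n) / e) :=
      Finset.prod_pos fun n _ => by simp only [hM]; positivity
    have hlogP : Real.log P ≤ 5 + 5 * Real.log (D + 1) + 2 * (R + 1) := by
      have h126 : Real.log 126 ≤ 5 := by
        rw [Real.log_le_iff_le_exp (by norm_num)]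
        have h := Real.exp_one_gt_d9
        have h8 : Real.exp 5 = Real.exp 1 ^ 5 := by rw [← Real.exp_nat_mul]; norm_num
        rw [h8]
        calc (126 : ℝ) ≤ 2.7182818283 ^ 5 := by norm_num
          _ ≤ _ := by gcongr
      rw [hPdef, div_inv_eq_mul, Real.log_mul (by positivity) (by positivity),
        Real.log_mul (by positivity) (by positivity), Real.log_mul (by positivity) (by positivity),
        Real.log_pow, Real.log_pow, hA, Real.log_exp]
      have h9 : Real.log D ≤ Real.log (D + 1) := Real.log_le_log (by positivity) (by linarith)
      push_cast
      linarith
    have hlogG : Real.log (((D * (K + 1) : ℕ) : ℝ) + 1) ≤ 2 * Real.log (D + 1) + (R + 1) := by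
      have h10 : ((D * (K + 1) : ℕ) : ℝ) + 1 ≤ (D + 1) * (Real.exp (R + 1) * (D + 1)) := by
        have h11 : (K : ℝ) + 1 ≤ Real.exp (R + 1) * (D + 1) := by
          have h12 : R + 2 ≤ Real.exp (R + 1) := by linarith [Real.add_one_le_exp (R + 1)]
          have h13 : √(D : ℝ) ≤ D + 1 := by nlinarith
          calc (K : ℝ) + 1 ≤ R * √D + 2 * √D := by linarith
            _ = (R + 2) * √D := by ring
            _ ≤ _ := by gcongr
        push_cast
        have h14 : (0 : ℝ) ≤ K := Nat.cast_nonneg _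
        nlinarith
      have h15 := Real.log_le_log (by positivity) h10
      rw [Real.log_mul (by positivity) (by positivity), Real.log_mul (by positivity) (by positivity),
        Real.log_exp] at h15
      linarith
    have hlogP0 : 0 ≤ Real.log P := Real.log_nonneg hP
    have hmain := Real.log_le_log (by exact_mod_cast h0) hcard
    rw [Real.log_mul (by positivity) (by positivity), Real.log_mul (by positivity) hprod0.ne',
      Real.log_pow, Real.log_pow] at hmain
    rw [← hK] at hmain
    push_cast at hmain hlogG
    have hfin : ((K : ℝ) + 1) * Real.log (D * (K + 1) + 1) + K * Real.log P ≤
        (R * √D + 2) * (8 + 7 * Real.log (D + 1) + 3 * R) := by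
      calc ((K : ℝ) + 1) * Real.log (D * (K + 1) + 1) + K * Real.log P
          ≤ ((K : ℝ) + 1) * Real.log (D * (K + 1) + 1) + (K + 1) * Real.log P := by
            gcongr; linarith
        _ = ((K : ℝ) + 1) * (Real.log (D * (K + 1) + 1) + Real.log P) := by ring
        _ ≤ ((K : ℝ) + 1) * (8 + 7 * Real.log (D + 1) + 3 * R) := by
            refine mul_le_mul_of_nonneg_left ?_ (by positivity)
            linarith
        _ ≤ _ := by gcongr
    linarith

/-- Volume comparison: a covering of the ellipsoid needs at least as many balls as the volumes of its
finite-dimensional sections dictate. -/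
lemma prod_div_le_card_of_cover {μ : ℕ → ℝ} (hμ : ∀ n, 0 < μ n) (S : Finset ℕ) {ε : ℝ} (hε : 0 < ε)
    (F : Finset (lp (fun _ : ℕ => ℝ) 2)) (hF : ∀ x ∈ ellipsoid μ, ∃ y ∈ F, dist x y ≤ ε) :
    ∏ n ∈ S, (μ n / ε) ≤ F.card := by
  classical
  set E := EuclideanSpace ℝ S
  set T : E →ₗ[ℝ] E := Matrix.toLpLin 2 2 (Matrix.diagonal fun n : S => μ n) with hT
  have hTdet : LinearMap.det T = ∏ n : S, μ n := by
    rw [hT, Matrix.toLpLin_eq_toLin, LinearMap.det_toLin, Matrix.det_diagonal]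
  have hTapp : ∀ (x : E) (n : S), T x n = μ n * x n := fun x n => by
    exact Matrix.mulVec_diagonal _ _ n
  set π : lp (fun _ : ℕ => ℝ) 2 → E := fun y => WithLp.toLp 2 fun n => y n with hπ
  have hsub : T '' Metric.closedBall 0 1 ⊆ ⋃ y ∈ F, Metric.closedBall (π y) ε := by
    rintro _ ⟨u, hu, rfl⟩
    have hu1 : ∑ n, u n ^ 2 ≤ 1 := by
      have h1 : ‖u‖ ^ 2 ≤ 1 := by
        have h2 : ‖u‖ ≤ 1 := by simpa using hu
        exact pow_le_one₀ (norm_nonneg _) h2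
      rw [EuclideanSpace.norm_sq_eq] at h1
      simpa using h1
    have hsupp : ∀ n ∉ S, (lpOfFinset S (T u) n / μ n) ^ 2 = 0 := fun n hn => by
      rw [lpOfFinset_apply_notMem _ hn]; simp
    have hmem : lpOfFinset S (T u) ∈ ellipsoid μ := by
      refine ⟨summable_of_ne_finset_zero hsupp, ?_⟩
      rw [tsum_eq_sum hsupp, ← Finset.sum_coe_sort]
      refine le_trans (Finset.sum_le_sum fun n _ => ?_) hu1
      rw [lpOfFinset_apply_mem, hTapp, mul_div_cancel_left₀ _ (hμ n).ne']
    obtain ⟨y, hy, hdist⟩ := hF _ hmem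
    refine Set.mem_biUnion hy (Metric.mem_closedBall.2 ?_)
    refine le_trans (abs_le_of_sq_le_sq' ?_ dist_nonneg).2 hdist
    rw [dist_comm _ y, dist_lpOfFinset_sq, dist_comm, EuclideanSpace.dist_eq,
      Real.sq_sqrt (Finset.sum_nonneg fun _ _ => sq_nonneg _)]
    refine le_add_of_le_of_nonneg (Finset.sum_le_sum fun n _ => ?_) (tsum_nonneg fun _ => sq_nonneg _)
    rw [Real.dist_eq, sq_abs]
  have hvol := (measure_mono (μ := volume) hsub).trans (measure_biUnion_finset_le F _)
  rw [Measure.addHaar_image_linearMap, hTdet] at hvol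
  simp only [Measure.addHaar_closedBall _ _ hε.le] at hvol
  rw [Finset.sum_const, nsmul_eq_mul, Measure.addHaar_closedBall _ _ zero_le_one, one_pow,
    ENNReal.ofReal_one, one_mul, ← mul_assoc] at hvol
  have hb0 : volume (Metric.ball (0 : E) 1) ≠ 0 := (Metric.measure_ball_pos _ _ one_pos).ne'
  have hbt : volume (Metric.ball (0 : E) 1) ≠ ∞ := measure_ball_lt_top.ne
  rw [ENNReal.mul_le_mul_iff_left hb0 hbt, ← ENNReal.ofReal_natCast,
    ← ENNReal.ofReal_mul (Nat.cast_nonneg _), ENNReal.ofReal_le_ofReal_iff (by positivity),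
    abs_of_pos (Finset.prod_pos fun (n : S) _ => hμ n), finrank_euclideanSpace] at hvol
  rw [Finset.prod_div_distrib, Finset.prod_const, div_le_iff₀ (by positivity),
    ← Finset.prod_coe_sort]
  simpa using hvol

lemma log_coveringNumber_le_of_cover {μ : ℕ → ℝ} {ε : ℝ} (F : Finset (lp (fun _ : ℕ => ℝ) 2))
    (hF : ∀ x ∈ ellipsoid μ, ∃ y ∈ F, dist x y ≤ ε) :
    Real.log (coveringNumber ε (ellipsoid μ)) ≤ Real.log F.card := by
  have hle : coveringNumber ε (ellipsoid μ) ≤ F.card := Nat.sInf_le ⟨F, rfl, hF⟩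
  rcases Nat.eq_zero_or_pos (coveringNumber ε (ellipsoid μ)) with h0 | h0
  · rw [h0, Nat.cast_zero, Real.log_zero]
    exact Real.log_natCast_nonneg _
  · exact Real.log_le_log (by exact_mod_cast h0) (by exact_mod_cast hle)

lemma sum_log_div_le_log_coveringNumber {μ : ℕ → ℝ} (hμ : ∀ n, 0 < μ n) (S : Finset ℕ) {ε : ℝ}
    (hε : 0 < ε) (hex : ∃ F : Finset (lp (fun _ : ℕ => ℝ) 2),
      ∀ x ∈ ellipsoid μ, ∃ y ∈ F, dist x y ≤ ε) :
    ∑ n ∈ S, Real.log (μ n / ε) ≤ Real.log (coveringNumber ε (ellipsoid μ)) := by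
  obtain ⟨F₀, hF₀⟩ := hex
  obtain ⟨F, hcard, hF⟩ := Nat.sInf_mem (s := {n : ℕ | ∃ s : Finset (lp (fun _ : ℕ => ℝ) 2),
    s.card = n ∧ ∀ x ∈ ellipsoid μ, ∃ y ∈ s, dist x y ≤ ε}) ⟨_, F₀, rfl, hF₀⟩
  have hpos : ∀ n, 0 < μ n / ε := fun n => div_pos (hμ n) hε
  rw [← Real.log_prod fun n _ => (hpos n).ne']
  refine Real.log_le_log (Finset.prod_pos fun n _ => hpos n) ?_
  rw [coveringNumber, ← hcard]
  exact prod_div_le_card_of_cover hμ S hε F hF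

lemma sum_range_log_sub (X : ℝ) (d : ℕ) :
    ∑ n ∈ Finset.range d, (Real.log X - Real.log ((n : ℝ) + 1)) =
      d * Real.log X - Real.log d.factorial := by
  rw [Finset.sum_sub_distrib, Finset.sum_const, Finset.card_range, nsmul_eq_mul,
    ← Finset.prod_range_add_one_eq_factorial, Nat.cast_prod,
    Real.log_prod fun n _ => by positivity]
  push_cast
  rfl

lemma sum_log_sub_le (S : Finset ℕ) {X : ℝ} (hX : 0 < X) :
    ∑ n ∈ S, (Real.log X - Real.log ((n : ℝ) + 1)) ≤ X := by
  classical
  have hsign : ∀ n : ℕ, n < ⌊X⌋₊ ↔ (n : ℝ) + 1 ≤ X := fun n => by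
    rw [← Nat.succ_le_iff, Nat.le_floor_iff hX.le]; push_cast; rfl
  have h1 : ∑ n ∈ S, (Real.log X - Real.log ((n : ℝ) + 1)) ≤
      ∑ n ∈ Finset.range ⌊X⌋₊, (Real.log X - Real.log ((n : ℝ) + 1)) := by
    rw [← Finset.sum_inter_add_sum_sdiff S (Finset.range ⌊X⌋₊)]
    have h2 : ∑ n ∈ S \ Finset.range ⌊X⌋₊, (Real.log X - Real.log ((n : ℝ) + 1)) ≤ 0 := by
      refine Finset.sum_nonpos fun n hn => ?_
      rw [Finset.mem_sdiff, Finset.mem_range, hsign, not_le] at hn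
      exact sub_nonpos.2 (Real.log_le_log hX hn.2.le)
    have h3 := Finset.sum_le_sum_of_subset_of_nonneg
      (f := fun n : ℕ => Real.log X - Real.log ((n : ℝ) + 1))
      (Finset.inter_subset_right (s₁ := S) (s₂ := Finset.range ⌊X⌋₊)) fun n hn _ => by
        rw [Finset.mem_range, hsign] at hn
        exact sub_nonneg.2 (Real.log_le_log (by positivity) hn)
    linarith
  refine h1.trans ?_
  rw [sum_range_log_sub, ← Real.log_pow, ← Real.log_div (by positivity) (by positivity),
    Real.log_le_iff_le_exp (by positivity)]
  exact Real.pow_div_factorial_le_exp X hX.le _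

lemma log_factorial_le {d : ℕ} (hd : 1 ≤ d) :
    Real.log d.factorial ≤ d * Real.log d - d + Real.log d + 1 := by
  induction d, hd using Nat.le_induction with
  | base => simp
  | succ d hd ih =>
    have hd0 : (0 : ℝ) < d := by exact_mod_cast hd
    have h1 := Real.one_sub_inv_le_log_of_pos (show (0 : ℝ) < (d + 1) / d by positivity)
    rw [Real.log_div (by positivity) (by positivity), inv_div] at h1
    have h2 : (1 : ℝ) - d / (d + 1) = 1 / (d + 1) := by field_simp; ring
    rw [h2, div_le_iff₀ (by positivity)] at h1
    rw [Nat.factorial_succ, Nat.cast_mul, Real.log_mul (by positivity) (by positivity)]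
    push_cast
    linarith

lemma le_sum_log_sub {X : ℝ} (hX : 1 ≤ X) :
    X - 2 - Real.log X ≤
      ∑ n ∈ Finset.range ⌊X⌋₊, (Real.log X - Real.log ((n : ℝ) + 1)) := by
  rw [sum_range_log_sub]
  have hd : 1 ≤ ⌊X⌋₊ := Nat.one_le_floor_iff _ |>.2 hX
  have hd0 : (0 : ℝ) < ⌊X⌋₊ := by exact_mod_cast hd
  have h1 := log_factorial_le hd
  have h2 := Nat.floor_le (zero_le_one.trans hX)
  have h3 := Nat.lt_floor_add_one X
  have h4 := Real.log_le_log hd0 h2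
  nlinarith

section PowerSums

variable {β : ℝ}

lemma sum_range_rpow_neg_le (hβ0 : 0 ≤ β) (hβ1 : β < 1) (d : ℕ) :
    (1 - β) * ∑ n ∈ Finset.range d, ((n : ℝ) + 1) ^ (-β) ≤ (d : ℝ) ^ (1 - β) := by
  induction d with
  | zero => simp [Real.zero_rpow (by linarith : 1 - β ≠ 0)]
  | succ d ih =>
    rw [Finset.sum_range_succ, mul_add]
    have hN : (0 : ℝ) < (d : ℝ) + 1 := by positivity
    have h1 := rpow_one_add_le_one_add_mul_self (s := -1 / ((d : ℝ) + 1)) (p := 1 - β)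
      (by rw [le_div_iff₀ hN]; linarith [(Nat.cast_nonneg d : (0 : ℝ) ≤ d)]) (by linarith)
      (by linarith)
    have h2 : (d : ℝ) ^ (1 - β) = ((d : ℝ) + 1) ^ (1 - β) * (1 + -1 / ((d : ℝ) + 1)) ^ (1 - β) := by
      rw [← Real.mul_rpow hN.le]
      · congr 1; field_simp; ring
      · rw [show 1 + -1 / ((d : ℝ) + 1) = d / (d + 1) by field_simp; ring]; positivity
    have h3 : ((d : ℝ) + 1) ^ (-β) = ((d : ℝ) + 1) ^ (1 - β) / ((d : ℝ) + 1) := by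
      rw [show -β = (1 - β) - 1 by ring, Real.rpow_sub_one hN.ne']
    have h4 : ((d : ℝ) + 1) ^ (1 - β) * (1 + -1 / ((d : ℝ) + 1)) ^ (1 - β) ≤
        ((d : ℝ) + 1) ^ (1 - β) * (1 + (1 - β) * (-1 / ((d : ℝ) + 1))) := by gcongr
    have h5 : ((d : ℝ) + 1) ^ (1 - β) * (1 + (1 - β) * (-1 / ((d : ℝ) + 1))) =
        ((d : ℝ) + 1) ^ (1 - β) - (1 - β) * (((d : ℝ) + 1) ^ (1 - β) / ((d : ℝ) + 1)) := by ring
    push_cast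
    rw [h3]
    linarith

lemma le_sum_range_rpow_neg (hβ0 : 0 ≤ β) (hβ1 : β < 1) (d : ℕ) :
    ((d : ℝ) + 1) ^ (1 - β) - 1 ≤ (1 - β) * ∑ n ∈ Finset.range d, ((n : ℝ) + 1) ^ (-β) := by
  induction d with
  | zero => simp
  | succ d ih =>
    rw [Finset.sum_range_succ, mul_add]
    have hN : (0 : ℝ) < (d : ℝ) + 1 := by positivity
    have h1 := rpow_one_add_le_one_add_mul_self (s := 1 / ((d : ℝ) + 1)) (p := 1 - β)
      (by have : 0 ≤ 1 / ((d : ℝ) + 1) := by positivity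
          linarith) (by linarith) (by linarith)
    have h2 : ((d : ℝ) + 1 + 1) ^ (1 - β) =
        ((d : ℝ) + 1) ^ (1 - β) * (1 + 1 / ((d : ℝ) + 1)) ^ (1 - β) := by
      rw [← Real.mul_rpow hN.le (by positivity)]
      congr 1; field_simp
    have h3 : ((d : ℝ) + 1) ^ (-β) = ((d : ℝ) + 1) ^ (1 - β) / ((d : ℝ) + 1) := by
      rw [show -β = (1 - β) - 1 by ring, Real.rpow_sub_one hN.ne']
    have h4 : ((d : ℝ) + 1) ^ (1 - β) * (1 + 1 / ((d : ℝ) + 1)) ^ (1 - β) ≤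
        ((d : ℝ) + 1) ^ (1 - β) * (1 + (1 - β) * (1 / ((d : ℝ) + 1))) := by gcongr
    have h5 : ((d : ℝ) + 1) ^ (1 - β) * (1 + (1 - β) * (1 / ((d : ℝ) + 1))) =
        ((d : ℝ) + 1) ^ (1 - β) + (1 - β) * (((d : ℝ) + 1) ^ (1 - β) / ((d : ℝ) + 1)) := by ring
    push_cast
    rw [h3]
    linarith

lemma abs_sum_floor_rpow_neg_sub_le (hβ0 : 0 ≤ β) (hβ1 : β < 1) {X : ℝ} (hX : 0 ≤ X) :
    |∑ n ∈ Finset.range ⌊X⌋₊, ((n : ℝ) + 1) ^ (-β) - X ^ (1 - β) / (1 - β)| ≤ 1 / (1 - β) := by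
  have hτ : 0 < 1 - β := by linarith
  have h1 := sum_range_rpow_neg_le hβ0 hβ1 ⌊X⌋₊
  have h2 := le_sum_range_rpow_neg hβ0 hβ1 ⌊X⌋₊
  have h3 : (⌊X⌋₊ : ℝ) ^ (1 - β) ≤ X ^ (1 - β) :=
    Real.rpow_le_rpow (by positivity) (Nat.floor_le hX) hτ.le
  have h4 : X ^ (1 - β) ≤ ((⌊X⌋₊ : ℝ) + 1) ^ (1 - β) :=
    Real.rpow_le_rpow hX (Nat.lt_floor_add_one X).le hτ.le
  have h5 : ∑ n ∈ Finset.range ⌊X⌋₊, ((n : ℝ) + 1) ^ (-β) - X ^ (1 - β) / (1 - β) =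
      ((1 - β) * ∑ n ∈ Finset.range ⌊X⌋₊, ((n : ℝ) + 1) ^ (-β) - X ^ (1 - β)) / (1 - β) := by
    field_simp
  rw [h5, abs_div, abs_of_pos hτ]
  gcongr
  rw [abs_le]
  constructor <;> linarith

lemma sum_floor_isLittleO (hβ0 : 0 ≤ β) (hβ1 : β < 1) {γ : ℝ} {y : ℕ → ℝ}
    (hy : (fun n : ℕ => y n - γ * ((n : ℝ) + 1) ^ (-β)) =o[atTop] fun n : ℕ => ((n : ℝ) + 1) ^ (-β)) :
    (fun X : ℝ => ∑ n ∈ Finset.range ⌊X⌋₊, y n - γ / (1 - β) * X ^ (1 - β)) =o[atTop]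
      fun X : ℝ => X ^ (1 - β) := by
  have hτ : 0 < 1 - β := by linarith
  have htop : Tendsto (fun X : ℝ => X ^ (1 - β)) atTop atTop := tendsto_rpow_atTop hτ
  have hconst : ∀ C : ℝ, (fun _ : ℝ => C) =o[atTop] fun X : ℝ => X ^ (1 - β) := fun C =>
    isLittleO_const_left.2 (Or.inr (tendsto_norm_atTop_atTop.comp htop))
  have hmain : (fun X : ℝ => ∑ n ∈ Finset.range ⌊X⌋₊, ((n : ℝ) + 1) ^ (-β) -
      X ^ (1 - β) / (1 - β)) =o[atTop] fun X : ℝ => X ^ (1 - β) := by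
    refine IsBigO.trans_isLittleO ?_ (hconst (1 / (1 - β)))
    refine IsBigO.of_bound 1 ?_
    filter_upwards [eventually_ge_atTop 0] with X hX
    rw [one_mul, Real.norm_eq_abs, Real.norm_of_nonneg (by positivity)]
    exact abs_sum_floor_rpow_neg_sub_le hβ0 hβ1 hX
  have hsumO : (fun X : ℝ => ∑ n ∈ Finset.range ⌊X⌋₊, ((n : ℝ) + 1) ^ (-β)) =O[atTop]
      fun X : ℝ => X ^ (1 - β) := by
    have h := hmain.isBigO.add ((isBigO_refl (fun X : ℝ => X ^ (1 - β)) atTop).const_mul_left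
      (1 - β)⁻¹)
    refine h.congr_left fun X => ?_
    ring
  have hdiv : Tendsto (fun d : ℕ => ∑ n ∈ Finset.range d, ((n : ℝ) + 1) ^ (-β)) atTop atTop := by
    have h1 : Tendsto (fun d : ℕ => (((d : ℝ) + 1) ^ (1 - β) - 1) / (1 - β)) atTop atTop := by
      refine Tendsto.atTop_div_const hτ (tendsto_atTop_add_const_right _ _ (htop.comp ?_))
      exact tendsto_atTop_add_const_right _ _ tendsto_natCast_atTop_atTop
    refine tendsto_atTop_mono (fun d => ?_) h1
    rw [div_le_iff₀ hτ, mul_comm]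
    exact le_sum_range_rpow_neg hβ0 hβ1 d
  have ho := (IsLittleO.sum_range hy (fun n => by positivity) hdiv).comp_tendsto
    (tendsto_nat_floor_atTop (α := ℝ))
  have h := (ho.trans_isBigO hsumO).add (hmain.const_mul_left γ)
  refine h.congr_left fun X => ?_
  simp only [Function.comp, Finset.sum_sub_distrib, ← Finset.mul_sum]
  ring

end PowerSums

lemma tendsto_natCast_add_one_rpow_neg {β : ℝ} (hβ : 0 < β) :
    Tendsto (fun n : ℕ => ((n : ℝ) + 1) ^ (-β)) atTop (𝓝 0) :=
  (tendsto_rpow_neg_atTop hβ).comp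
    (tendsto_atTop_add_const_right _ _ tendsto_natCast_atTop_atTop)

lemma tendsto_zero_of_sub_isLittleO_rpow_neg {β γ : ℝ} (hβγ : 0 < β ∨ (β = 0 ∧ γ = 0)) {w : ℕ → ℝ}
    (hw : (fun n : ℕ => w n - γ * ((n : ℝ) + 1) ^ (-β)) =o[atTop]
      fun n : ℕ => ((n : ℝ) + 1) ^ (-β)) :
    Tendsto w atTop (𝓝 0) := by
  rcases hβγ with hβ | ⟨rfl, rfl⟩
  · have h := hw.isBigO.trans_tendsto (tendsto_natCast_add_one_rpow_neg hβ) |>.add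
      ((tendsto_natCast_add_one_rpow_neg hβ).const_mul γ)
    simpa using h
  · have h : w =o[atTop] fun _ : ℕ => (1 : ℝ) := by simpa using hw
    exact (isLittleO_one_iff ℝ).1 h

/-- A two-term expansion of the semi-axes yields one for their logarithms. -/
lemma log_semiaxis_expansion {μ : ℕ → ℝ} (hμ : ∀ n, 0 < μ n) {c₁ c₂ α₁ α₂ : ℝ} (hc₁ : 0 < c₁)
    (hcase : 0 < α₂ - α₁ ∨ (α₂ - α₁ = 0 ∧ c₂ / c₁ = 0))
    (hasymp : (fun n : ℕ => μ n - c₁ * ((n : ℝ) + 1) ^ (-α₁) - c₂ * ((n : ℝ) + 1) ^ (-α₂))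
      =o[atTop] fun n : ℕ => ((n : ℝ) + 1) ^ (-α₂)) :
    (fun n : ℕ => (Real.log (μ n) - Real.log c₁ + α₁ * Real.log ((n : ℝ) + 1)) -
      c₂ / c₁ * ((n : ℝ) + 1) ^ (-(α₂ - α₁))) =o[atTop]
        fun n : ℕ => ((n : ℝ) + 1) ^ (-(α₂ - α₁)) := by
  set w : ℕ → ℝ := fun n => μ n * ((n : ℝ) + 1) ^ α₁ / c₁ - 1 with hw
  have hN : ∀ n : ℕ, (0 : ℝ) < (n : ℝ) + 1 := fun n => by positivity
  have hpow : ∀ n : ℕ, ((n : ℝ) + 1) ^ (-(α₂ - α₁)) =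
      ((n : ℝ) + 1) ^ α₁ * ((n : ℝ) + 1) ^ (-α₂) := fun n => by
    rw [← Real.rpow_add (hN n)]; congr 1; ring
  have hwo : (fun n : ℕ => w n - c₂ / c₁ * ((n : ℝ) + 1) ^ (-(α₂ - α₁))) =o[atTop]
      fun n : ℕ => ((n : ℝ) + 1) ^ (-(α₂ - α₁)) := by
    have h := ((isBigO_refl (fun n : ℕ => ((n : ℝ) + 1) ^ α₁) atTop).mul_isLittleO
      hasymp).const_mul_left c₁⁻¹
    refine h.congr (fun n => ?_) fun n => (hpow n).symm
    have h1 : ((n : ℝ) + 1) ^ α₁ * ((n : ℝ) + 1) ^ (-α₁) = 1 := by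
      rw [← Real.rpow_add (hN n), add_neg_cancel, Real.rpow_zero]
    rw [hpow, hw]
    field_simp
    linear_combination (-c₁) * h1
  have hw0 : Tendsto w atTop (𝓝 0) := tendsto_zero_of_sub_isLittleO_rpow_neg hcase hwo
  have hwO : w =O[atTop] fun n : ℕ => ((n : ℝ) + 1) ^ (-(α₂ - α₁)) := by
    refine (hwo.isBigO.add ((isBigO_refl _ _).const_mul_left (c₂ / c₁))).congr_left fun n => ?_
    ring
  have hlog : (fun n => Real.log (1 + w n) - w n) =o[atTop] w := by
    have h1 := (Real.hasDerivAt_log one_ne_zero).isLittleO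
    have h2 : Tendsto (fun n => 1 + w n) atTop (𝓝 1) := by simpa using hw0.const_add 1
    have h3 := h1.comp_tendsto h2
    simpa [Function.comp_def] using h3
  refine ((hlog.trans_isBigO hwO).add hwo).congr_left fun n => ?_
  have h1 : 1 + w n = μ n * ((n : ℝ) + 1) ^ α₁ / c₁ := by rw [hw]; ring
  have h2 := Real.rpow_pos_of_pos (hN n) α₁
  rw [h1, Real.log_div (mul_pos (hμ n) h2).ne' hc₁.ne', Real.log_mul (hμ n).ne' h2.ne',
    Real.log_rpow (hN n)]
  ring

section Threshold

variable {a β C κ : ℝ} {y : ℕ → ℝ} {v : ℝ → ℝ}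

lemma eventually_neg_of_large_index (ha : 0 < a) (hy0 : Tendsto y atTop (𝓝 0))
    (hv : Tendsto v atTop (𝓝 0)) (hκ : 0 < κ) :
    ∀ᶠ X : ℝ in atTop, ∀ n : ℕ, (1 + κ) * X < (n : ℝ) + 1 →
      a * (Real.log X - Real.log ((n : ℝ) + 1)) + y n + v X < 0 := by
  set θ := a * Real.log (1 + κ) / 2 with hθ
  have hθ0 : 0 < θ := by
    have := Real.log_pos (show 1 < 1 + κ by linarith)
    positivity
  obtain ⟨n₀, hn₀⟩ := eventually_atTop.1 (hy0.eventually_lt_const hθ0)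
  filter_upwards [hv.eventually_lt_const hθ0, eventually_ge_atTop (n₀ : ℝ), eventually_gt_atTop 0]
    with X hvX hXn hX0 n hn
  have h1 : n₀ ≤ n := by
    have h2 : (n₀ : ℝ) < (n : ℝ) + 1 := by nlinarith
    exact Nat.lt_succ_iff.1 (by exact_mod_cast h2)
  have h3 := hn₀ n h1
  have h4 := Real.log_lt_log (by positivity) hn
  rw [Real.log_mul (by positivity) hX0.ne'] at h4
  have h5 : a * (Real.log X - Real.log ((n : ℝ) + 1)) < a * (-Real.log (1 + κ)) :=
    mul_lt_mul_of_pos_left (by linarith) ha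
  linarith

lemma eventually_pos_of_small_index (ha : 0 < a) (hβ : 0 ≤ β)
    (hC : ∀ n, |y n| ≤ C * ((n : ℝ) + 1) ^ (-β))
    (hy0 : Tendsto y atTop (𝓝 0)) (hv0 : ∀ X, 0 ≤ v X) (hκ : 0 < κ) (hκ1 : κ < 1) :
    ∀ᶠ X : ℝ in atTop, ∀ n : ℕ, (n : ℝ) + 1 < (1 - κ) * X →
      0 < a * (Real.log X - Real.log ((n : ℝ) + 1)) + y n + v X := by
  set θ := -(a * Real.log (1 - κ)) with hθ
  have hθ0 : 0 < θ := by
    have := Real.log_neg (show 0 < 1 - κ by linarith) (by linarith)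
    nlinarith
  obtain ⟨n₀, hn₀⟩ := eventually_atTop.1 (hy0.eventually_const_lt (neg_lt_zero.2 hθ0))
  filter_upwards [Real.tendsto_log_atTop.eventually_gt_atTop (C / a + Real.log ((n₀ : ℝ) + 1)),
    eventually_gt_atTop 0] with X hXlog hX0 n hn
  have hvX := hv0 X
  rcases le_or_gt n₀ n with h1 | h1
  · have h3 := hn₀ n h1
    have h4 := Real.log_lt_log (by positivity) hn
    rw [Real.log_mul (by linarith) hX0.ne'] at h4
    have h5 : a * (-Real.log (1 - κ)) < a * (Real.log X - Real.log ((n : ℝ) + 1)) :=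
      mul_lt_mul_of_pos_left (by linarith) ha
    linarith
  · have h2 : Real.log ((n : ℝ) + 1) ≤ Real.log ((n₀ : ℝ) + 1) :=
      Real.log_le_log (by positivity) (by gcongr)
    have hC0 : 0 ≤ C := by simpa using (abs_nonneg _).trans (hC 0)
    have h3 : |y n| ≤ C := (hC n).trans (mul_le_of_le_one_right hC0
      (Real.rpow_le_one_of_one_le_of_nonpos (by linarith [(Nat.cast_nonneg n : (0 : ℝ) ≤ n)])
        (by linarith)))
    have h4 : a * (C / a) < a * (Real.log X - Real.log ((n : ℝ) + 1)) :=
      mul_lt_mul_of_pos_left (by linarith) ha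
    rw [mul_div_cancel₀ _ ha.ne'] at h4
    have := (abs_le.1 h3).1
    linarith

/-- Summing over the indices above the threshold differs little from summing over an initial
segment. -/
lemma eventually_sum_threshold_le (ha : 0 < a) (hβ : 0 ≤ β) (hβ1 : β ≤ 1)
    (hC : ∀ n, |y n| ≤ C * ((n : ℝ) + 1) ^ (-β)) (hy0 : Tendsto y atTop (𝓝 0))
    (hv : Tendsto v atTop (𝓝 0)) (hv0 : ∀ X, 0 ≤ v X) (hκ : 0 < κ) (hκ1 : κ ≤ 1 / 2) :
    ∀ᶠ X : ℝ in atTop, ∀ S : Finset ℕ,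
      (∀ n, n ∈ S ↔ 0 < a * (Real.log X - Real.log ((n : ℝ) + 1)) + y n + v X) →
      ∑ n ∈ S, y n ≤ ∑ n ∈ Finset.range ⌊X⌋₊, y n + 6 * C * κ * X ^ (1 - β) := by
  classical
  have hC0 : 0 ≤ C := by simpa using (abs_nonneg _).trans (hC 0)
  filter_upwards [eventually_neg_of_large_index ha hy0 hv hκ,
    eventually_pos_of_small_index ha hβ hC hy0 hv0 hκ (by linarith), eventually_gt_atTop 0,
    eventually_ge_atTop κ⁻¹] with X hlarge hsmall hX hXκ S hS
  have hfloor : ∀ n : ℕ, n < ⌊X⌋₊ ↔ (n : ℝ) + 1 ≤ X := fun n => by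
    rw [← Nat.succ_le_iff, Nat.le_floor_iff hX.le]; push_cast; rfl
  set r := Finset.range ⌊X⌋₊ with hr
  set W : Finset ℕ := Finset.Ico (⌈(1 - κ) * X⌉₊ - 1) ⌊(1 + κ) * X⌋₊ with hW
  have hmemW : ∀ n : ℕ, (1 - κ) * X ≤ (n : ℝ) + 1 → (n : ℝ) + 1 ≤ (1 + κ) * X → n ∈ W :=
    fun n h1 h2 => by
      rw [hW, Finset.mem_Ico, tsub_le_iff_right, Nat.ceil_le, ← Nat.succ_le_iff,
        Nat.le_floor_iff (by positivity)]
      push_cast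
      exact ⟨h1, h2⟩
  have hsub : (S \ r) ∪ (r \ S) ⊆ W := by
    intro n hn
    rcases Finset.mem_union.1 hn with hn | hn
    · rw [Finset.mem_sdiff, hr, Finset.mem_range, hfloor, not_le, hS] at hn
      refine hmemW n (by nlinarith) (not_lt.1 fun h => ?_)
      exact lt_asymm hn.1 (hlarge n h)
    · rw [Finset.mem_sdiff, hr, Finset.mem_range, hfloor, hS] at hn
      refine hmemW n (not_lt.1 fun h => hn.2 (hsmall n h)) (by nlinarith)
  have h1κ : 0 < (1 - κ) * X := mul_pos (by linarith) hX
  have hyW : ∀ n ∈ W, |y n| ≤ 2 * C * X ^ (-β) := fun n hn => by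
    rw [hW, Finset.mem_Ico, tsub_le_iff_right, Nat.ceil_le] at hn
    have h1 := hn.1
    push_cast at h1
    have h2 : X / 2 ≤ (n : ℝ) + 1 := by nlinarith
    calc |y n| ≤ C * ((n : ℝ) + 1) ^ (-β) := hC n
      _ ≤ C * (X / 2) ^ (-β) := by
          refine mul_le_mul_of_nonneg_left ?_ hC0
          exact Real.rpow_le_rpow_of_nonpos (by positivity) h2 (by linarith)
      _ = C * (2 ^ β * X ^ (-β)) := by
          rw [Real.div_rpow hX.le (by norm_num), Real.rpow_neg (by norm_num : (0 : ℝ) ≤ 2),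
            div_inv_eq_mul, mul_comm (X ^ (-β))]
      _ ≤ C * (2 * X ^ (-β)) := by
          gcongr
          calc (2 : ℝ) ^ β ≤ 2 ^ (1 : ℝ) := Real.rpow_le_rpow_of_exponent_le (by norm_num) hβ1
            _ = 2 := Real.rpow_one 2
      _ = _ := by ring
  have hcardW : (W.card : ℝ) ≤ 3 * κ * X := by
    have h1 : 1 ≤ ⌈(1 - κ) * X⌉₊ := Nat.one_le_ceil_iff.2 h1κ
    have h2 : W.card + ⌈(1 - κ) * X⌉₊ ≤ ⌊(1 + κ) * X⌋₊ + 1 ∨ W.card = 0 := by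
      rw [hW, Nat.card_Ico]; omega
    rcases h2 with h2 | h2
    · have h3 : (W.card : ℝ) + ⌈(1 - κ) * X⌉₊ ≤ ⌊(1 + κ) * X⌋₊ + 1 := by exact_mod_cast h2
      have h4 := Nat.floor_le (show 0 ≤ (1 + κ) * X by positivity)
      have h5 := Nat.le_ceil ((1 - κ) * X)
      have h6 : 1 ≤ κ * X := by
        rw [inv_le_iff_one_le_mul₀ hκ] at hXκ
        linarith
      nlinarith
    · rw [h2, Nat.cast_zero]; positivity
  have hdiff : ∑ n ∈ S, y n - ∑ n ∈ r, y n ≤ ∑ n ∈ W, |y n| := by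
    rw [← Finset.sum_sdiff_sub_sum_sdiff]
    have h1 : ∑ n ∈ (S \ r) ∪ (r \ S), |y n| = ∑ n ∈ S \ r, |y n| + ∑ n ∈ r \ S, |y n| :=
      Finset.sum_union disjoint_sdiff_sdiff
    have h2 := Finset.sum_le_sum_of_subset_of_nonneg (f := fun n => |y n|) hsub
      fun _ _ _ => abs_nonneg _
    have h3 := Finset.sum_le_sum fun n (_ : n ∈ S \ r) => le_abs_self (y n)
    have h4 := Finset.sum_le_sum fun n (_ : n ∈ r \ S) => neg_le_abs (y n)
    rw [Finset.sum_neg_distrib] at h4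
    linarith
  have hW1 : ∑ n ∈ W, |y n| ≤ 6 * C * κ * X ^ (1 - β) := by
    calc ∑ n ∈ W, |y n| ≤ W.card * (2 * C * X ^ (-β)) := by
          simpa using Finset.sum_le_card_nsmul W _ _ hyW
      _ ≤ 3 * κ * X * (2 * C * X ^ (-β)) := by gcongr
      _ = 6 * C * κ * (X * X ^ (-β)) := by ring
      _ = _ := by
          rw [sub_eq_add_neg, Real.rpow_add hX, Real.rpow_one]
  linarith

end Threshold

lemma isLittleO_rpow_rpow_atTop {p q : ℝ} (hpq : p < q) :
    (fun X : ℝ => X ^ p) =o[atTop] fun X : ℝ => X ^ q := by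
  refine isLittleO_of_tendsto' ?_ ?_
  · filter_upwards [eventually_gt_atTop 0] with X hX h
    exact absurd h (Real.rpow_pos_of_pos hX q).ne'
  · refine (tendsto_rpow_neg_atTop (sub_pos.2 hpq)).congr' ?_
    filter_upwards [eventually_gt_atTop 0] with X hX
    rw [← Real.rpow_sub hX, neg_sub]

lemma covering_error_isLittleO {β : ℝ} (hβ : β < 1 / 2) (a B : ℝ) :
    (fun X : ℝ => √(⌈2 * X⌉₊ : ℝ) + ((a * Real.log X + B) * √(⌈2 * X⌉₊ : ℝ) + 2) *
      (8 + 7 * Real.log ((⌈2 * X⌉₊ : ℝ) + 1) + 3 * (a * Real.log X + B))) =o[atTop]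
        fun X : ℝ => X ^ (1 - β) := by
  set s := (1 / 2 - β) / 4 with hs
  have hs0 : 0 < s := by rw [hs]; linarith
  have htop : Tendsto (fun X : ℝ => X ^ s) atTop atTop := tendsto_rpow_atTop hs0
  have hconst : ∀ c : ℝ, (fun _ : ℝ => c) =O[atTop] fun X : ℝ => X ^ s := fun c =>
    (isLittleO_const_left.2 (Or.inr (tendsto_norm_atTop_atTop.comp htop))).isBigO
  have hlog : (fun X : ℝ => Real.log X) =O[atTop] fun X : ℝ => X ^ s :=
    (isLittleO_log_rpow_atTop hs0).isBigO
  have hD : ∀ᶠ X : ℝ in atTop, (⌈2 * X⌉₊ : ℝ) ≤ 3 * X := by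
    filter_upwards [eventually_ge_atTop 1] with X hX
    linarith [Nat.ceil_lt_add_one (show 0 ≤ 2 * X by linarith)]
  have hsqrt : (fun X : ℝ => √(⌈2 * X⌉₊ : ℝ)) =O[atTop] fun X : ℝ => √X := by
    refine IsBigO.of_bound √3 ?_
    filter_upwards [hD] with X hX
    rw [Real.norm_of_nonneg (Real.sqrt_nonneg _), Real.norm_of_nonneg (Real.sqrt_nonneg _),
      ← Real.sqrt_mul (by norm_num)]
    exact Real.sqrt_le_sqrt hX
  have hlogD : (fun X : ℝ => Real.log ((⌈2 * X⌉₊ : ℝ) + 1)) =O[atTop] fun X : ℝ => X ^ s := by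
    refine IsBigO.trans (IsBigO.of_bound 2 ?_) hlog
    filter_upwards [hD, eventually_ge_atTop 4] with X hX hX4
    rw [Real.norm_of_nonneg (Real.log_nonneg (by linarith [(Nat.cast_nonneg ⌈2 * X⌉₊ : (0 : ℝ) ≤ _)])),
      Real.norm_of_nonneg (Real.log_nonneg (by linarith))]
    have h1 : 2 * Real.log X = Real.log (X ^ 2) := by rw [Real.log_pow]; norm_num
    rw [h1]
    exact Real.log_le_log (by positivity) (by nlinarith)
  have hR : (fun X : ℝ => a * Real.log X + B) =O[atTop] fun X : ℝ => X ^ s :=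
    (hlog.const_mul_left a).add (hconst B)
  have hone : (fun _ : ℝ => (1 : ℝ)) =O[atTop] fun X : ℝ => √X := by
    refine IsBigO.of_bound 1 ?_
    filter_upwards [eventually_ge_atTop 1] with X hX
    rw [Real.norm_of_nonneg (Real.sqrt_nonneg _)]
    simpa using hX
  have h1 : (fun X : ℝ => (a * Real.log X + B) * √(⌈2 * X⌉₊ : ℝ) + 2) =O[atTop]
      fun X : ℝ => X ^ s * √X := by
    refine (hR.mul hsqrt).add ?_
    exact ((hconst 2).mul hone).congr_left fun X => by ring
  have h2 : (fun X : ℝ => 8 + 7 * Real.log ((⌈2 * X⌉₊ : ℝ) + 1) + 3 * (a * Real.log X + B)) =O[atTop]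
      fun X : ℝ => X ^ s :=
    ((hconst 8).add (hlogD.const_mul_left 7)).add (hR.const_mul_left 3)
  have h3 : (fun X : ℝ => √(⌈2 * X⌉₊ : ℝ)) =O[atTop] fun X : ℝ => X ^ s * √X * X ^ s :=
    (((hconst 1).mul hsqrt).mul (hconst 1)).congr_left fun X => by ring
  refine (h3.add (h1.mul h2)).trans_isLittleO ?_
  have h4 : (fun X : ℝ => X ^ (1 / 2 + 2 * s)) =o[atTop] fun X : ℝ => X ^ (1 - β) :=
    isLittleO_rpow_rpow_atTop (by rw [hs]; linarith)
  refine h4.congr' ?_ EventuallyEq.rfl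
  filter_upwards [eventually_gt_atTop 0] with X hX
  rw [Real.sqrt_eq_rpow, ← Real.rpow_add hX, ← Real.rpow_add hX]
  congr 1; ring

lemma log_div_semiaxis {m c₁ a X N : ℝ} (hm : 0 < m) (hc₁ : 0 < c₁) (hX : 0 < X) :
    Real.log (m / (c₁ * X ^ (-a))) =
      a * (Real.log X - Real.log N) + (Real.log m - Real.log c₁ + a * Real.log N) := by
  have hp := Real.rpow_pos_of_pos hX (-a)
  rw [Real.log_div hm.ne' (mul_pos hc₁ hp).ne', Real.log_mul hc₁.ne' hp.ne', Real.log_rpow hX]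
  ring

/-- Entropy of an ellipsoid at scale `c₁ X ^ (-a)`, from the expansion of the logarithms of its
semi-axes. -/
lemma log_coveringNumber_ellipsoid_isLittleO {μ : ℕ → ℝ} (hμ : ∀ n, 0 < μ n) {c₁ a β γ : ℝ}
    (hc₁ : 0 < c₁) (ha : 0 < a) (hβ1 : β < 1 / 2) (hβγ : 0 < β ∨ (β = 0 ∧ γ = 0))
    (hy : (fun n : ℕ => (Real.log (μ n) - Real.log c₁ + a * Real.log ((n : ℝ) + 1)) -
      γ * ((n : ℝ) + 1) ^ (-β)) =o[atTop] fun n : ℕ => ((n : ℝ) + 1) ^ (-β)) :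
    (fun X : ℝ => Real.log (coveringNumber (c₁ * X ^ (-a)) (ellipsoid μ)) - a * X -
      γ / (1 - β) * X ^ (1 - β)) =o[atTop] fun X : ℝ => X ^ (1 - β) := by
  classical
  have hβ0 : 0 ≤ β := by rcases hβγ with h | h <;> linarith
  have hτ : 0 < 1 - β := by linarith
  set y : ℕ → ℝ := fun n => Real.log (μ n) - Real.log c₁ + a * Real.log ((n : ℝ) + 1) with hydef
  have hy0 : Tendsto y atTop (𝓝 0) := tendsto_zero_of_sub_isLittleO_rpow_neg hβγ hy
  obtain ⟨C, hC0, hC⟩ : ∃ C > 0, ∀ n, |y n| ≤ C * ((n : ℝ) + 1) ^ (-β) := by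
    have hO : y =O[atTop] fun n : ℕ => ((n : ℝ) + 1) ^ (-β) := by
      refine (hy.isBigO.add ((isBigO_refl _ _).const_mul_left γ)).congr_left fun n => ?_
      ring
    obtain ⟨C, hC0, hC⟩ := bound_of_isBigO_nat_atTop hO
    refine ⟨C, hC0, fun n => ?_⟩
    have hp : 0 < ((n : ℝ) + 1) ^ (-β) := by positivity
    simpa [abs_of_pos hp] using hC hp.ne'
  have hyC : ∀ n, y n ≤ C := fun n => by
    refine (le_abs_self _).trans ((hC n).trans (mul_le_of_le_one_right hC0.le ?_))
    exact Real.rpow_le_one_of_one_le_of_nonpos (by linarith [(Nat.cast_nonneg n : (0 : ℝ) ≤ n)])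
      (by linarith)
  set v : ℝ → ℝ := fun X => 2 / (⌈2 * X⌉₊ : ℝ) with hvdef
  have hv0 : ∀ X, 0 ≤ v X := fun X => by positivity
  have hv : Tendsto v atTop (𝓝 0) := by
    refine Tendsto.const_div_atTop (tendsto_natCast_atTop_atTop.comp
      (tendsto_nat_ceil_atTop.comp (tendsto_id.const_mul_atTop two_pos))) 2
  set err : ℝ → ℝ := fun X => √(⌈2 * X⌉₊ : ℝ) +
    ((a * Real.log X + (C + 2)) * √(⌈2 * X⌉₊ : ℝ) + 2) *
      (8 + 7 * Real.log ((⌈2 * X⌉₊ : ℝ) + 1) + 3 * (a * Real.log X + (C + 2))) with herr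
  have herro : err =o[atTop] fun X : ℝ => X ^ (1 - β) := covering_error_isLittleO hβ1 a (C + 2)
  have hlogo : (fun X : ℝ => Real.log X) =o[atTop] fun X : ℝ => X ^ (1 - β) :=
    isLittleO_log_rpow_atTop hτ
  have hconst : ∀ c : ℝ, (fun _ : ℝ => c) =o[atTop] fun X : ℝ => X ^ (1 - β) := fun c =>
    isLittleO_const_left.2 (Or.inr (tendsto_norm_atTop_atTop.comp (tendsto_rpow_atTop hτ)))
  have hYo := sum_floor_isLittleO hβ0 (by linarith : β < 1) hy
  have hsandwich : ∀ κ : ℝ, 0 < κ → κ ≤ 1 / 2 → ∀ᶠ X : ℝ in atTop,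
      Real.log (coveringNumber (c₁ * X ^ (-a)) (ellipsoid μ)) ≤
        a * X + 2 + ∑ n ∈ Finset.range ⌊X⌋₊, y n + 6 * C * κ * X ^ (1 - β) + err X ∧
      a * X - 2 * a - a * Real.log X + ∑ n ∈ Finset.range ⌊X⌋₊, y n ≤
        Real.log (coveringNumber (c₁ * X ^ (-a)) (ellipsoid μ)) := by
    intro κ hκ hκ1
    filter_upwards [eventually_sum_threshold_le ha hβ0 (by linarith) hC hy0 hv hv0 hκ hκ1,
      eventually_neg_of_large_index ha hy0 hv one_pos, eventually_ge_atTop 1] with X hthr hlarge hX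
    have hX0 : 0 < X := by linarith
    set D := ⌈2 * X⌉₊ with hD
    have hD0 : 0 < D := Nat.ceil_pos.2 (by linarith)
    have hD1 : (1 : ℝ) ≤ D := by exact_mod_cast hD0
    set ε := c₁ * X ^ (-a) with hε
    have hε0 : 0 < ε := by positivity
    set e := ε * Real.exp (-v X) with he
    have he0 : 0 < e := by positivity
    have hlog : ∀ n : ℕ, Real.log (μ n / ε) =
        a * (Real.log X - Real.log ((n : ℝ) + 1)) + y n := fun n => log_div_semiaxis (hμ n) hc₁ hX0
    have hloge : ∀ n : ℕ, Real.log (μ n / e) =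
        a * (Real.log X - Real.log ((n : ℝ) + 1)) + y n + v X := fun n => by
      rw [← hlog, he, ← div_div, Real.log_div (div_pos (hμ n) hε0).ne' (Real.exp_pos _).ne',
        Real.log_exp]
      ring
    have hiff : ∀ n : ℕ, e < μ n ↔
        0 < a * (Real.log X - Real.log ((n : ℝ) + 1)) + y n + v X := fun n => by
      rw [← hloge, Real.log_pos_iff (div_pos (hμ n) he0).le, one_lt_div he0]
    set S := (Finset.range D).filter fun n => e < μ n with hS
    have hSmem : ∀ n, n ∈ S ↔ e < μ n := fun n => by
      rw [hS, Finset.mem_filter, Finset.mem_range, and_iff_right_iff_imp]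
      intro hn
      by_contra hnD
      have h1 : (D : ℝ) ≤ n := by exact_mod_cast not_lt.1 hnD
      have h2 := Nat.le_ceil (2 * X)
      exact lt_asymm ((hiff n).1 hn) (hlarge n (by linarith))
    have hcard : S.card ≤ D := by
      simpa using Finset.card_filter_le (Finset.range D) fun n => e < μ n
    have hvX : v X ≤ 2 := by
      simp only [hvdef]; exact div_le_self (by norm_num) hD1
    obtain ⟨F, hF, hFcard⟩ := exists_cover_ellipsoid_exp hμ (R := a * Real.log X + (C + 2)) he0 hSmem
      hcard hD0 (by have := Real.log_nonneg hX; positivity) fun n _ => by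
        rw [hloge]
        have h1 : 0 ≤ Real.log ((n : ℝ) + 1) :=
          Real.log_nonneg (by linarith [(Nat.cast_nonneg n : (0 : ℝ) ≤ n)])
        have h2 := hyC n
        nlinarith
    have hrad : e * Real.exp (2 / D) = ε := by
      rw [he, mul_assoc, ← Real.exp_add]
      simp [hvdef, hD]
    rw [hrad] at hF
    constructor
    · refine (log_coveringNumber_le_of_cover F hF).trans ?_
      have h1 : ∑ n ∈ S, Real.log (μ n / e) ≤ a * X + ∑ n ∈ S, y n + 2 := by
        rw [Finset.sum_congr rfl fun n _ => hloge n, Finset.sum_add_distrib,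
          Finset.sum_add_distrib, ← Finset.mul_sum, Finset.sum_const, nsmul_eq_mul]
        have h2 := mul_le_mul_of_nonneg_left (sum_log_sub_le S hX0) ha.le
        have h3 : (S.card : ℝ) * v X ≤ 2 := by
          calc (S.card : ℝ) * v X ≤ D * v X := by
                have := hv0 X
                gcongr
            _ = 2 := mul_div_cancel₀ 2 (by positivity)
        linarith
      have h4 := hthr S fun n => (hSmem n).trans (hiff n)
      simp only [herr]
      linarith
    · refine le_trans ?_ (sum_log_div_le_log_coveringNumber hμ (Finset.range ⌊X⌋₊) hε0 ⟨F, hF⟩)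
      have h6 : ∑ n ∈ Finset.range ⌊X⌋₊, Real.log (μ n / ε) =
          a * ∑ n ∈ Finset.range ⌊X⌋₊, (Real.log X - Real.log ((n : ℝ) + 1)) +
            ∑ n ∈ Finset.range ⌊X⌋₊, y n := by
        rw [Finset.mul_sum, ← Finset.sum_add_distrib]
        exact Finset.sum_congr rfl fun n _ => hlog n
      have h5 := mul_le_mul_of_nonneg_left (le_sum_log_sub hX) ha.le
      linarith
  rw [isLittleO_iff]
  intro c hc
  set κ := min (1 / 2) (c / (24 * C)) with hκdef
  have hκ : 0 < κ := lt_min (by norm_num) (by positivity)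
  have hκc : 6 * C * κ ≤ c / 4 := by
    have h1 : κ ≤ c / (24 * C) := min_le_right _ _
    rw [le_div_iff₀ (by positivity)] at h1
    linarith
  have hc4 : 0 < c / 4 := by positivity
  filter_upwards [hsandwich κ hκ (min_le_left _ _), isLittleO_iff.1 hYo hc4,
    isLittleO_iff.1 herro hc4, isLittleO_iff.1 (hconst 2) hc4,
    isLittleO_iff.1 (hconst (2 * a)) hc4, isLittleO_iff.1 (hlogo.const_mul_left a) hc4,
    eventually_gt_atTop 0] with X hX h1 h2 h3 h4 h5 hX0
  have hp := Real.rpow_pos_of_pos hX0 (1 - β)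
  rw [Real.norm_eq_abs, Real.norm_of_nonneg hp.le] at h1 h2 h3 h4 h5
  rw [Real.norm_eq_abs, Real.norm_of_nonneg hp.le]
  have h6 := mul_le_mul_of_nonneg_right hκc hp.le
  rw [abs_le] at h1 h2 h3 h4 h5 ⊢
  constructor <;> linarith [hX.1, hX.2]

theorem metric_entropy_ellipsoid_second_order
    (μ : ℕ → ℝ) (hμpos : ∀ n, 0 < μ n)
    (c₁ c₂ α₁ α₂ : ℝ) (hc₁ : 0 < c₁) (hα₁ : 0 < α₁) (hα₂ : 0 < α₂)
    (hcase : (α₁ < α₂ ∧ α₂ < α₁ + 1 / 2) ∨ (α₁ = α₂ ∧ c₂ = 0))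
    (hasymp : (fun n : ℕ => μ n - c₁ * ((n : ℝ) + 1) ^ (-α₁) - c₂ * ((n : ℝ) + 1) ^ (-α₂))
      =o[atTop] fun n : ℕ => ((n : ℝ) + 1) ^ (-α₂)) :
    (fun ε : ℝ => metricEntropy ε (ellipsoid μ)
        - α₁ * c₁ ^ (1 / α₁) / Real.log 2 * ε ^ (-(1 / α₁))
        - c₂ * c₁ ^ ((1 - α₂) / α₁) / (Real.log 2 * (α₁ - α₂ + 1))
            * ε ^ (-((α₁ - α₂ + 1) / α₁)))
      =o[𝓝[>] 0] fun ε : ℝ => ε ^ (-((α₁ - α₂ + 1) / α₁)) := by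
  have hβγ : 0 < α₂ - α₁ ∨ (α₂ - α₁ = 0 ∧ c₂ / c₁ = 0) := by
    rcases hcase with h | ⟨h1, h2⟩
    · exact Or.inl (by linarith)
    · exact Or.inr ⟨by linarith, by simp [h2]⟩
  have hβ1 : α₂ - α₁ < 1 / 2 := by rcases hcase with h | h <;> linarith
  have hmain := log_coveringNumber_ellipsoid_isLittleO hμpos hc₁ hα₁ hβ1 hβγ
    (log_semiaxis_expansion hμpos hc₁ hβγ hasymp)
  have hlog2 : 0 < Real.log 2 := Real.log_pos one_lt_two
  set τ := α₁ - α₂ + 1 with hτdef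
  have hτ : 1 - (α₂ - α₁) = τ := by rw [hτdef]; ring
  have hτ0 : 0 < τ := by linarith
  rw [hτ] at hmain
  have hXtop : Tendsto (fun ε : ℝ => (c₁ / ε) ^ (1 / α₁)) (𝓝[>] 0) atTop := by
    refine (tendsto_rpow_atTop (by positivity)).comp ?_
    exact tendsto_inv_nhdsGT_zero.const_mul_atTop hc₁
  have h := (hmain.comp_tendsto hXtop).const_mul_left (Real.log 2)⁻¹
  have hpow : ∀ ε : ℝ, 0 < ε → ((c₁ / ε) ^ (1 / α₁)) ^ τ = c₁ ^ (τ / α₁) * ε ^ (-(τ / α₁)) :=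
    fun ε hε => by
      rw [← Real.rpow_mul (by positivity), one_div_mul_eq_div, Real.div_rpow hc₁.le hε.le,
        Real.rpow_neg hε.le, div_eq_mul_inv]
  have h' := h.congr' (f₂ := fun ε : ℝ => metricEntropy ε (ellipsoid μ)
        - α₁ * c₁ ^ (1 / α₁) / Real.log 2 * ε ^ (-(1 / α₁))
        - c₂ * c₁ ^ ((1 - α₂) / α₁) / (Real.log 2 * τ) * ε ^ (-(τ / α₁)))
    (g₂ := fun ε : ℝ => c₁ ^ (τ / α₁) * ε ^ (-(τ / α₁))) ?_ ?_
  · exact h'.trans_isBigO ((isBigO_refl _ _).const_mul_left _)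
  · filter_upwards [self_mem_nhdsWithin] with ε hε
    have hε0 : 0 < ε := hε
    have h1 : c₁ * ((c₁ / ε) ^ (1 / α₁)) ^ (-α₁) = ε := by
      rw [← Real.rpow_mul (by positivity), show 1 / α₁ * -α₁ = -1 by field_simp,
        Real.rpow_neg_one]
      field_simp
    have h2 : (c₁ / ε) ^ (1 / α₁) = c₁ ^ (1 / α₁) * ε ^ (-(1 / α₁)) := by
      rw [Real.div_rpow hc₁.le hε0.le, Real.rpow_neg hε0.le, div_eq_mul_inv]
    have h3 : c₁ ^ (τ / α₁) = c₁ * c₁ ^ ((1 - α₂) / α₁) := by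
      rw [show τ / α₁ = 1 + (1 - α₂) / α₁ by rw [hτdef]; field_simp; ring, Real.rpow_add hc₁,
        Real.rpow_one]
    simp only [Function.comp, h1, hpow ε hε0, metricEntropy, Real.logb]
    rw [h2, h3]
    field_simp
  · filter_upwards [self_mem_nhdsWithin] with ε hε
    exact hpow ε hε
end
end

section
/- Let κ₁ > 0, κ₂ ∈ ℝ, and β₁ > β₂ > 0, and let {ζ_n}_{n≥1} be a sequence of positive real numbers satisfying n = κ₁ ζ_n^{-β₁} + κ₂ ζ_n^{-β₂} + o(ζ_n^{-β₂}) as n → ∞. Then ζ_n = κ₁^{1/β₁} n^{-1/β₁} + (κ₁^{1/β₁ - β₂/β₁} κ₂ / β₁) n^{β₂/β₁ - 1/β₁ - 1} + o(n^{β₂/β₁ - 1/β₁ - 1}) as n → ∞. -/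
open Filter Asymptotics
open scoped BigOperators

noncomputable section

open scoped Topology

/-- If `N = κ u + κ' u ^ γ + o(u ^ γ)` with `0 ≤ γ ≤ 1` and `N → ∞`, then `u → ∞`. -/
lemma tendsto_atTop_of_isLittleO_sub_rpow {ι : Type*} {l : Filter ι} {κ κ' γ : ℝ} (hκ : 0 < κ)
    (hγ0 : 0 ≤ γ) (hγ1 : γ ≤ 1) {N u : ι → ℝ} (hu : ∀ i, 0 < u i) (hN : Tendsto N l atTop)
    (h : (fun i => N i - κ * u i - κ' * u i ^ γ) =o[l] fun i => u i ^ γ) :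
    Tendsto u l atTop := by
  have hC : 0 < κ + (|κ'| + 1) := by positivity
  have hlin : Tendsto (fun i => (κ + (|κ'| + 1)) * u i + (|κ'| + 1)) l atTop := by
    refine tendsto_atTop_mono' l ?_ hN
    filter_upwards [h.bound one_pos] with i hi
    have hpos : 0 < u i ^ γ := Real.rpow_pos_of_pos (hu i) γ
    rw [Real.norm_eq_abs, Real.norm_eq_abs, abs_of_pos hpos, one_mul] at hi
    have hle : u i ^ γ ≤ 1 + u i := by
      rcases le_total (u i) 1 with h1 | h1
      · linarith [Real.rpow_le_one (hu i).le h1 hγ0, hu i]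
      · have := Real.rpow_le_rpow_of_exponent_le h1 hγ1
        rw [Real.rpow_one] at this
        linarith
    have hκ' : κ' * u i ^ γ ≤ |κ'| * u i ^ γ :=
      mul_le_mul_of_nonneg_right (le_abs_self κ') hpos.le
    have hmul : (|κ'| + 1) * u i ^ γ ≤ (|κ'| + 1) * (1 + u i) :=
      mul_le_mul_of_nonneg_left hle (by positivity)
    linarith [(abs_le.mp hi).2]
  refine (tendsto_const_mul_atTop_of_pos hC).mp ?_
  exact (tendsto_atTop_add_const_right l (-(|κ'| + 1)) hlin).congr fun i => by ring

/-- Second-order expansion of `(N / (κ u)) ^ a` when `N = κ u + κ' u ^ γ + o(u ^ γ)`. -/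
lemma tendsto_rpow_sub_one_div_rpow {ι : Type*} {l : Filter ι} {κ κ' γ : ℝ} (a : ℝ) (hκ : 0 < κ)
    (hγ1 : γ < 1) {N u : ι → ℝ} (hu : ∀ i, 0 < u i) (hNpos : ∀ i, 0 < N i)
    (hutop : Tendsto u l atTop)
    (h : (fun i => N i - κ * u i - κ' * u i ^ γ) =o[l] fun i => u i ^ γ) :
    Tendsto (fun i => ((N i / (κ * u i)) ^ a - 1) / N i ^ (γ - 1)) l
      (𝓝 (a * (κ' / κ) * κ ^ (1 - γ))) := by
  set w : ι → ℝ := fun i => N i / (κ * u i) - 1 with hw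
  have hratio : Tendsto (fun i => w i / u i ^ (γ - 1)) l (𝓝 (κ' / κ)) := by
    have h0 := ((h.tendsto_div_nhds_zero).add_const κ').div_const κ
    rw [zero_add] at h0
    refine h0.congr fun i => ?_
    have hp := (Real.rpow_pos_of_pos (hu i) γ).ne'
    have hui := (hu i).ne'
    simp only [hw]
    rw [Real.rpow_sub_one hui]
    field_simp
    ring
  have hwzero : Tendsto w l (𝓝 0) := by
    have hu0 : Tendsto (fun i => u i ^ (γ - 1)) l (𝓝 0) := by
      have := (tendsto_rpow_neg_atTop (sub_pos.mpr hγ1)).comp hutop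
      simpa [Function.comp_def] using this
    have := hratio.mul hu0
    rw [mul_zero] at this
    exact this.congr fun i => div_mul_cancel₀ _ (Real.rpow_pos_of_pos (hu i) _).ne'
  have hquot : Tendsto (fun i => (N i / u i) ^ (1 - γ)) l (𝓝 (κ ^ (1 - γ))) := by
    have : Tendsto (fun i => N i / u i) l (𝓝 κ) := by
      have := (hwzero.add_const 1).const_mul κ
      rw [zero_add, mul_one] at this
      refine this.congr fun i => ?_
      have hui := (hu i).ne'
      simp only [hw]
      field_simp
      ring
    exact this.rpow_const (Or.inl hκ.ne')
  have hderiv : HasDerivAt (fun x : ℝ => (1 + x) ^ a) a 0 := by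
    have := ((hasDerivAt_id (0 : ℝ)).const_add 1).rpow_const (p := a) (Or.inl (by simp))
    simpa using this
  have hslope : Tendsto (fun i => dslope (fun x : ℝ => (1 + x) ^ a) 0 (w i)) l (𝓝 a) := by
    have := (continuousAt_dslope_same.mpr hderiv.differentiableAt).tendsto
    rw [dslope_same, hderiv.deriv] at this
    exact this.comp hwzero
  refine ((hslope.mul hratio).mul hquot).congr fun i => ?_
  have hd := sub_smul_dslope (fun x : ℝ => (1 + x) ^ a) 0 (w i)
  have h1w : 1 + w i = N i / (κ * u i) := by simp [hw]
  simp only [sub_zero, smul_eq_mul, add_zero, Real.one_rpow, h1w] at hd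
  rw [← hd, Real.div_rpow (hNpos i).le (hu i).le, ← neg_sub γ 1, Real.rpow_neg (hNpos i).le,
    Real.rpow_neg (hu i).le]
  have hp := (Real.rpow_pos_of_pos (hu i) (γ - 1)).ne'
  have hq := (Real.rpow_pos_of_pos (hNpos i) (γ - 1)).ne'
  field_simp

theorem inversion_lemma_second_order
    (κ₁ κ₂ β₁ β₂ : ℝ) (hκ₁ : 0 < κ₁) (hβ₂ : 0 < β₂) (hββ : β₂ < β₁)
    -- `ζ n` is the term `ζ_{n+1}` of the sequence
    (ζ : ℕ → ℝ) (hζpos : ∀ n, 0 < ζ n)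
    (hasymp : (fun n : ℕ => ((n : ℝ) + 1) - κ₁ * ζ n ^ (-β₁) - κ₂ * ζ n ^ (-β₂))
      =o[atTop] fun n : ℕ => ζ n ^ (-β₂)) :
    (fun n : ℕ => ζ n - κ₁ ^ (1 / β₁) * ((n : ℝ) + 1) ^ (-(1 / β₁))
        - κ₁ ^ (1 / β₁ - β₂ / β₁) * κ₂ / β₁ * ((n : ℝ) + 1) ^ (β₂ / β₁ - 1 / β₁ - 1))
      =o[atTop] fun n : ℕ => ((n : ℝ) + 1) ^ (β₂ / β₁ - 1 / β₁ - 1) := by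
  have hβ₁ : 0 < β₁ := hβ₂.trans hββ
  have hγ0 : 0 < β₂ / β₁ := div_pos hβ₂ hβ₁
  have hγ1 : β₂ / β₁ < 1 := (div_lt_one hβ₁).mpr hββ
  have hNpos : ∀ n : ℕ, (0 : ℝ) < (n : ℝ) + 1 := fun n => n.cast_add_one_pos
  have hN : Tendsto (fun n : ℕ => (n : ℝ) + 1) atTop atTop :=
    tendsto_atTop_add_const_right _ 1 tendsto_natCast_atTop_atTop
  have hu : ∀ n, 0 < ζ n ^ (-β₁) := fun n => Real.rpow_pos_of_pos (hζpos n) _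
  have hpow : ∀ n, ζ n ^ (-β₂) = (ζ n ^ (-β₁)) ^ (β₂ / β₁) := fun n => by
    rw [← Real.rpow_mul (hζpos n).le]
    congr 1
    field_simp
  simp only [hpow] at hasymp
  have hutop := tendsto_atTop_of_isLittleO_sub_rpow hκ₁ hγ0.le hγ1.le hu hN hasymp
  have hlim := tendsto_rpow_sub_one_div_rpow (1 / β₁) hκ₁ hγ1 hu hNpos hutop hasymp
  have hconst : κ₁ ^ (1 / β₁) * (1 / β₁ * (κ₂ / κ₁) * κ₁ ^ (1 - β₂ / β₁))
      = κ₁ ^ (1 / β₁ - β₂ / β₁) * κ₂ / β₁ := by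
    rw [Real.rpow_sub hκ₁, Real.rpow_sub hκ₁, Real.rpow_one]
    field_simp
  have hdiff := (hlim.const_mul (κ₁ ^ (1 / β₁))).sub_const
    (κ₁ ^ (1 / β₁ - β₂ / β₁) * κ₂ / β₁)
  rw [hconst, sub_self] at hdiff
  have hscale : ∀ n : ℕ, ((n : ℝ) + 1) ^ (β₂ / β₁ - 1 / β₁ - 1) ≠ 0 :=
    fun n => (Real.rpow_pos_of_pos (hNpos n) _).ne'
  refine (isLittleO_iff_tendsto fun n hn => absurd hn (hscale n)).mpr (hdiff.congr fun n => ?_)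
  have hζ : (((n : ℝ) + 1) / (κ₁ * ζ n ^ (-β₁))) ^ (1 / β₁)
      = ((n : ℝ) + 1) ^ (1 / β₁) / κ₁ ^ (1 / β₁) * ζ n := by
    rw [Real.div_rpow (hNpos n).le (mul_pos hκ₁ (hu n)).le, Real.mul_rpow hκ₁.le (hu n).le,
      ← Real.rpow_mul (hζpos n).le, show -β₁ * (1 / β₁) = -1 by field_simp, Real.rpow_neg_one]
    have := (hζpos n).ne'
    field_simp
  have hsplit : ((n : ℝ) + 1) ^ (β₂ / β₁ - 1 / β₁ - 1)
      = ((n : ℝ) + 1) ^ (β₂ / β₁ - 1) / ((n : ℝ) + 1) ^ (1 / β₁) := by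
    rw [← Real.rpow_sub (hNpos n)]
    congr 1
    ring
  rw [sub_div _ _ (((n : ℝ) + 1) ^ (β₂ / β₁ - 1 / β₁ - 1)), mul_div_cancel_right₀ _ (hscale n),
    hζ, hsplit, Real.rpow_neg (hNpos n).le]
  have hA := (Real.rpow_pos_of_pos hκ₁ (1 / β₁)).ne'
  have hB := (Real.rpow_pos_of_pos (hNpos n) (1 / β₁)).ne'
  have hC := (Real.rpow_pos_of_pos (hNpos n) (β₂ / β₁ - 1)).ne'
  generalize κ₁ ^ (1 / β₁) = A at *
  generalize ((n : ℝ) + 1) ^ (1 / β₁) = B at *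
  generalize ((n : ℝ) + 1) ^ (β₂ / β₁ - 1) = C at *
  field_simp
end
end

section
/- Let α₁, c₁ > 0 and let {λ_n}_{n≥1} be a sequence of positive real numbers with λ_n ~ c₁ n^{-α₁} as n → ∞. Then sup_{N ∈ ℕ*} { 2^{-m/N} (∏_{n=1}^N λ_n)^{1/N} } = c₁ (α₁/ln 2)^{α₁} m^{-α₁} + o(m^{-α₁}) as m → ∞. -/
open Filter Asymptotics
open scoped BigOperators

noncomputable section

/-- The function `t ↦ 2 ^ (-t) * t ^ α` attains its maximum on `(0, ∞)` at `α / log 2`. -/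
theorem two_rpow_neg_mul_rpow_le {α t : ℝ} (hα : 0 < α) (ht : 0 < t) :
    (2 : ℝ) ^ (-t) * t ^ α ≤ Real.exp (-α) * (α / Real.log 2) ^ α := by
  have hl : 0 < Real.log 2 := Real.log_pos one_lt_two
  have hs : 0 < α / Real.log 2 := div_pos hα hl
  rw [Real.rpow_def_of_pos two_pos, Real.rpow_def_of_pos ht, Real.rpow_def_of_pos hs,
    ← Real.exp_add, ← Real.exp_add, Real.exp_le_exp]
  have h := Real.log_le_sub_one_of_pos (div_pos ht hs)
  rw [Real.log_div ht.ne' hs.ne'] at h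
  have h' := mul_le_mul_of_nonneg_right h hα.le
  have e : (t / (α / Real.log 2) - 1) * α = Real.log 2 * t - α := by field_simp
  linarith

theorem tendsto_log_factorial_div_sub_log :
    Tendsto (fun n : ℕ => Real.log (n.factorial : ℝ) / n - Real.log n) atTop (nhds (-1)) := by
  have h1 : Tendsto (fun n : ℕ => Real.log (Stirling.stirlingSeq n)) atTop
      (nhds (Real.log (√Real.pi))) :=
    (Real.continuousAt_log (by positivity)).tendsto.comp Stirling.tendsto_stirlingSeq_sqrt_pi
  have h2 : Tendsto (fun n : ℕ => Real.log (Stirling.stirlingSeq n) / n) atTop (nhds 0) :=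
    h1.div_atTop tendsto_natCast_atTop_atTop
  have h3 : Tendsto (fun n : ℕ => Real.log (n : ℝ) / n) atTop (nhds 0) :=
    (Real.isLittleO_log_id_atTop.tendsto_div_nhds_zero).comp tendsto_natCast_atTop_atTop
  have h4 : Tendsto (fun n : ℕ => Real.log 2 / (n : ℝ)) atTop (nhds 0) :=
    tendsto_const_nhds.div_atTop tendsto_natCast_atTop_atTop
  have h5 := (h2.add ((h4.add h3).const_mul (1 / 2))).sub_const 1
  refine Tendsto.congr' ?_ (by simpa using h5)
  filter_upwards [eventually_gt_atTop 0] with n hn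
  have hn' : (0 : ℝ) < n := by exact_mod_cast hn
  rw [Stirling.log_stirlingSeq_formula, Real.log_mul two_ne_zero hn'.ne',
    Real.log_div hn'.ne' (Real.exp_pos 1).ne', Real.log_exp]
  field_simp
  ring

/-- If `lam n ~ c * (n + 1) ^ (-α)`, then the geometric mean of the first `N` terms is
asymptotic to `c * exp α * N ^ (-α)`. -/
theorem tendsto_rpow_mul_geometric_mean {α c : ℝ} (hc : 0 < c)
    {lam : ℕ → ℝ} (hpos : ∀ n, 0 < lam n)
    (hasymp : Tendsto (fun n : ℕ => lam n / (c * ((n : ℝ) + 1) ^ (-α))) atTop (nhds 1)) :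
    Tendsto (fun N : ℕ => (N : ℝ) ^ α * (∏ n ∈ Finset.range N, lam n) ^ (1 / (N : ℝ))) atTop
      (nhds (c * Real.exp α)) := by
  have h1 : Tendsto (fun n : ℕ => Real.log (lam n / (c * ((n : ℝ) + 1) ^ (-α)))) atTop
      (nhds 0) := by
    simpa [Function.comp_def] using (Real.continuousAt_log one_ne_zero).tendsto.comp hasymp
  have h2 := ((h1.cesaro.sub (tendsto_log_factorial_div_sub_log.const_mul α)).add_const
    (Real.log c)).rexp
  have e : Real.exp (0 - α * (-1) + Real.log c) = c * Real.exp α := by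
    rw [Real.exp_add, Real.exp_log hc]; ring_nf
  rw [e] at h2
  refine h2.congr' ?_
  filter_upwards [eventually_gt_atTop 0] with N hN
  have hN' : (0 : ℝ) < N := by exact_mod_cast hN
  rw [Real.rpow_def_of_pos hN', Real.rpow_def_of_pos (Finset.prod_pos fun n _ => hpos n),
    ← Real.exp_add, Real.log_prod (fun n _ => (hpos n).ne'),
    ← Finset.prod_range_add_one_eq_factorial]
  push_cast
  rw [Real.log_prod (fun n _ => by positivity)]
  have e2 : ∀ n : ℕ, Real.log (lam n / (c * ((n : ℝ) + 1) ^ (-α)))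
      = Real.log (lam n) - Real.log c + α * Real.log ((n : ℝ) + 1) := fun n => by
    have hn : (0 : ℝ) < (n : ℝ) + 1 := by positivity
    rw [Real.log_div (hpos n).ne' (by positivity), Real.log_mul hc.ne' (by positivity),
      Real.log_rpow hn]
    ring
  simp only [e2, Finset.sum_add_distrib, Finset.sum_sub_distrib, Finset.sum_const,
    Finset.card_range, nsmul_eq_mul, ← Finset.mul_sum]
  congr 1
  field_simp
  ring

/-- If `g N ~ A * N ^ (-α)`, then the supremum over `N` of `2 ^ (-m / N) * g N` is asymptotic to
`A * exp (-α) * (α / log 2) ^ α * m ^ (-α)`. -/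
theorem tendsto_rpow_mul_iSup {α A : ℝ} (hα : 0 < α) {g : ℕ → ℝ} (hg : ∀ N, 0 ≤ g N)
    (h : Tendsto (fun N : ℕ => (N : ℝ) ^ α * g N) atTop (nhds A)) :
    Tendsto (fun m : ℕ => (m : ℝ) ^ α * ⨆ N : ℕ+, (2 : ℝ) ^ (-(m : ℝ) / (N : ℝ)) * g N) atTop
      (nhds (A * (Real.exp (-α) * (α / Real.log 2) ^ α))) := by
  have hl : 0 < Real.log 2 := Real.log_pos one_lt_two
  set s := α / Real.log 2 with hs_def
  have hs : 0 < s := div_pos hα hl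
  set P := Real.exp (-α) * s ^ α with hP_def
  have hP : 0 < P := by positivity
  have key : ∀ m : ℕ, 0 < m → ∀ N : ℕ, 0 < N →
      (m : ℝ) ^ α * ((2 : ℝ) ^ (-(m : ℝ) / (N : ℝ)) * g N)
        = ((N : ℝ) ^ α * g N) * ((2 : ℝ) ^ (-((m : ℝ) / N)) * ((m : ℝ) / N) ^ α) := by
    intro m hm N hN
    have hN' : (0 : ℝ) < N := by exact_mod_cast hN
    rw [Real.div_rpow (by positivity) hN'.le, neg_div]
    field_simp
  have upper : ∀ B, A * P < B → ∀ᶠ m : ℕ in atTop, ∀ N : ℕ+,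
      (m : ℝ) ^ α * ((2 : ℝ) ^ (-(m : ℝ) / (N : ℝ)) * g N) ≤ B := by
    intro B hB
    have hA : 0 ≤ A := ge_of_tendsto' h fun N => mul_nonneg (by positivity) (hg N)
    have hB0 : 0 < B := lt_of_le_of_lt (by positivity) hB
    obtain ⟨N₀, hN₀⟩ := eventually_atTop.1 (h.eventually_lt_const ((lt_div_iff₀ hP).2 hB))
    have small : ∀ᶠ m : ℕ in atTop, ∀ N ∈ Finset.Ico 1 N₀,
        (m : ℝ) ^ α * ((2 : ℝ) ^ (-(m : ℝ) / (N : ℝ)) * g N) < B := by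
      rw [eventually_all_finset]
      intro N hN
      have hN' : (0 : ℝ) < N := by exact_mod_cast (Finset.mem_Ico.1 hN).1
      have t := ((tendsto_rpow_mul_exp_neg_mul_atTop_nhds_zero α (Real.log 2 / N)
        (by positivity)).comp tendsto_natCast_atTop_atTop).mul_const (g N)
      rw [zero_mul] at t
      refine (t.eventually_lt_const hB0).mono fun m hm => lt_of_eq_of_lt ?_ hm
      simp only [Function.comp_apply]
      rw [Real.rpow_def_of_pos two_pos, mul_assoc]
      congr 3
      ring
    filter_upwards [small, eventually_gt_atTop 0] with m hm hm0 N
    rcases lt_or_ge (N : ℕ) N₀ with hlt | hge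
    · exact (hm N (Finset.mem_Ico.2 ⟨N.pos, hlt⟩)).le
    · have hN' : (0 : ℝ) < (N : ℕ) := by exact_mod_cast N.pos
      have hm' : (0 : ℝ) < m := by exact_mod_cast hm0
      rw [key m hm0 N N.pos]
      calc _ ≤ B / P * P := mul_le_mul (hN₀ N hge).le
              (two_rpow_neg_mul_rpow_le hα (div_pos hm' hN')) (by positivity) (by positivity)
        _ = B := div_mul_cancel₀ _ hP.ne'
  refine tendsto_order.2 ⟨fun B hB => ?_, fun B hB => ?_⟩
  · have hN : Tendsto (fun m : ℕ => ⌈s⁻¹ * (m : ℝ)⌉₊) atTop atTop :=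
      tendsto_nat_ceil_atTop.comp
        (tendsto_natCast_atTop_atTop.const_mul_atTop (inv_pos.2 hs))
    have hq : Tendsto (fun m : ℕ => (m : ℝ) / (⌈s⁻¹ * (m : ℝ)⌉₊ : ℝ)) atTop (nhds s) := by
      have := ((tendsto_nat_ceil_mul_div_atTop (inv_pos.2 hs).le).comp
        tendsto_natCast_atTop_atTop (f := fun m : ℕ => (m : ℝ))).inv₀ (inv_pos.2 hs).ne'
      simpa [Function.comp_def] using this
    have hphi : Tendsto (fun t : ℝ => (2 : ℝ) ^ (-t) * t ^ α) (nhds s) (nhds P) := by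
      have e : P = (2 : ℝ) ^ (-s) * s ^ α := by
        rw [hP_def, Real.rpow_def_of_pos two_pos, hs_def]
        congr 2
        field_simp
      rw [e]
      exact ((Real.continuous_const_rpow two_ne_zero).continuousAt.comp
        continuousAt_neg).mul (Real.continuousAt_rpow_const s α (Or.inl hs.ne'))
    filter_upwards [((h.comp hN).mul (hphi.comp hq)).eventually_const_lt hB,
      upper _ (lt_add_one _), eventually_gt_atTop 0, hN.eventually_gt_atTop 0] with m h1 h2 hm hN0
    have hm' : (0 : ℝ) < m := by exact_mod_cast hm
    have hp : 0 < (m : ℝ) ^ α := by positivity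
    refine h1.trans_le ?_
    simp only [Function.comp_apply]
    rw [← key m hm _ hN0]
    refine mul_le_mul_of_nonneg_left ?_ hp.le
    refine le_ciSup (f := fun N : ℕ+ => (2 : ℝ) ^ (-(m : ℝ) / (N : ℝ)) * g N)
      ⟨(A * P + 1) / (m : ℝ) ^ α, ?_⟩ ⟨_, hN0⟩
    rintro _ ⟨N, rfl⟩
    exact (le_div_iff₀' hp).2 (h2 N)
  · obtain ⟨B', hB', hB'B⟩ := exists_between hB
    filter_upwards [upper B' hB', eventually_gt_atTop 0] with m h2 hm
    have hm' : (0 : ℝ) < m := by exact_mod_cast hm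
    have hp : 0 < (m : ℝ) ^ α := by positivity
    refine lt_of_le_of_lt ?_ hB'B
    exact (le_div_iff₀' hp).1 (ciSup_le fun N => (le_div_iff₀' hp).2 (h2 N))

theorem sup_geometric_mean_asymptotics
    (α₁ c₁ : ℝ) (hα₁ : 0 < α₁) (hc₁ : 0 < c₁)
    -- `lam n` is the eigenvalue `λ_{n+1}`, so that `∏ n in Finset.range N, lam n = ∏_{n=1}^N λ_n`
    (lam : ℕ → ℝ) (hpos : ∀ n, 0 < lam n)
    (hasymp : Tendsto (fun n : ℕ => lam n / (c₁ * ((n : ℝ) + 1) ^ (-α₁))) atTop (nhds 1)) :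
    (fun m : ℕ =>
        (⨆ N : ℕ+, (2 : ℝ) ^ (-(m : ℝ) / (N : ℝ))
          * (∏ n ∈ Finset.range (N : ℕ), lam n) ^ (1 / (N : ℝ)))
        - c₁ * (α₁ / Real.log 2) ^ α₁ * (m : ℝ) ^ (-α₁))
      =o[atTop] fun m : ℕ => (m : ℝ) ^ (-α₁) := by
  have h := tendsto_rpow_mul_iSup hα₁
    (fun N => Real.rpow_nonneg (Finset.prod_nonneg fun n _ => (hpos n).le) _)
    (tendsto_rpow_mul_geometric_mean hc₁ hpos hasymp)
  have e : c₁ * Real.exp α₁ * (Real.exp (-α₁) * (α₁ / Real.log 2) ^ α₁)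
      = c₁ * (α₁ / Real.log 2) ^ α₁ := by
    rw [Real.exp_neg]
    field_simp
  rw [e] at h
  have h0 := h.sub_const (c₁ * (α₁ / Real.log 2) ^ α₁)
  rw [sub_self] at h0
  refine (isLittleO_iff_tendsto' ?_).2 (h0.congr' ?_)
  · filter_upwards [eventually_gt_atTop 0] with m hm hz
    have hm' : (0 : ℝ) < m := by exact_mod_cast hm
    exact absurd hz (Real.rpow_pos_of_pos hm' _).ne'
  · filter_upwards [eventually_gt_atTop 0] with m hm
    have hm' : (0 : ℝ) < m := by exact_mod_cast hm
    have hp : (m : ℝ) ^ α₁ ≠ 0 := by positivity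
    rw [Real.rpow_neg hm'.le]
    field_simp
end
end

section
/- There exists a sequence κ : ℕ* → ℝ with lim_{d→∞} κ(d) = 1 such that for every d ∈ ℕ* and every ε ∈ (0,1), the covering number of the closed unit ball B₂ of ℂ^d with respect to the ‖·‖₂-norm satisfies N(ε; B₂, ‖·‖₂)^{1/(2d)} · ε ≤ κ(d). -/
open Filter
open scoped BigOperators

noncomputable section

section UnitBall

open MeasureTheory Module Set
open Metric hiding coveringNumber

variable {E : Type*} [NormedAddCommGroup E] [InnerProductSpace ℝ E] [FiniteDimensional ℝ E]

/-- A `δ`-separated subset of the unit ball has at most `(1 + 2 / δ) ^ n` points. -/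
theorem card_le_of_separated_unit_ball (s : Finset E) (δ : ℝ) (hδ : 0 < δ)
    (hs : ∀ c ∈ s, ‖c‖ ≤ 1) (h : ∀ c ∈ s, ∀ d ∈ s, c ≠ d → δ ≤ dist c d) :
    (s.card : ℝ) ≤ (1 + 2 / δ) ^ finrank ℝ E := by
  borelize E
  let μ : Measure E := Measure.addHaar
  have hD : Set.Pairwise (s : Set E) (Function.onFun Disjoint fun c => ball c (δ / 2)) := by
    intro c hc d hd hcd
    exact ball_disjoint_ball (by simpa using h c hc d hd hcd)
  have hsub : ⋃ c ∈ s, ball c (δ / 2) ⊆ ball (0 : E) (1 + δ / 2) := by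
    refine iUnion₂_subset fun x hx => ball_subset_ball' ?_
    rw [dist_zero_right]
    linarith [hs x hx]
  have hle := measureReal_mono (μ := μ) hsub measure_ball_lt_top.ne
  rw [measureReal_biUnion_finset hD (fun _ _ => measurableSet_ball)
    (fun _ _ => measure_ball_lt_top.ne)] at hle
  have h1 : 0 < μ.real (ball (0 : E) 1) :=
    ENNReal.toReal_pos (measure_ball_pos _ _ one_pos).ne' measure_ball_lt_top.ne
  have hball (x : E) {r : ℝ} (hr : 0 < r) :
      μ.real (ball x r) = r ^ finrank ℝ E * μ.real (ball 0 1) := by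
    rw [Measure.real, Measure.addHaar_ball_of_pos μ x hr, ENNReal.toReal_mul,
      ENNReal.toReal_ofReal (by positivity), Measure.real]
  simp only [hball _ (half_pos hδ), hball _ (show 0 < 1 + δ / 2 by positivity), Finset.sum_const,
    nsmul_eq_mul, ← mul_assoc] at hle
  have hle' := le_of_mul_le_mul_right hle h1
  rw [← le_div_iff₀ (by positivity), ← div_pow] at hle'
  rwa [show (1 + δ / 2) / (δ / 2) = 1 + 2 / δ by field_simp; ring] at hle'

/-- The unit ball has a `δ`-net of at most `(1 + 2 / δ) ^ n` of its points. -/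
theorem exists_net_unit_ball (δ : ℝ) (hδ : 0 < δ) :
    ∃ T : Finset E, (∀ x ∈ T, ‖x‖ ≤ 1) ∧ (T.card : ℝ) ≤ (1 + 2 / δ) ^ finrank ℝ E ∧
      ∀ x : E, ‖x‖ ≤ 1 → ∃ y ∈ T, dist x y ≤ δ := by
  classical
  let P : Finset E → Prop := fun s =>
    (∀ c ∈ s, ‖c‖ ≤ 1) ∧ ∀ c ∈ s, ∀ d ∈ s, c ≠ d → δ ≤ dist c d
  have hbdd : BddAbove (Finset.card '' {s | P s}) := by
    refine ⟨⌊(1 + 2 / δ) ^ finrank ℝ E⌋₊, ?_⟩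
    rintro _ ⟨s, hs, rfl⟩
    exact Nat.le_floor (card_le_of_separated_unit_ball s δ hδ hs.1 hs.2)
  obtain ⟨T, hT, hTcard⟩ := Nat.sSup_mem
    (s := Finset.card '' {s | P s}) ⟨_, ∅, by simp [P], rfl⟩ hbdd
  refine ⟨T, hT.1, card_le_of_separated_unit_ball T δ hδ hT.1 hT.2, fun x hx => ?_⟩
  by_contra! hfar
  have hxT : x ∉ T := fun hxT => by
    have := hfar x hxT
    rw [dist_self] at this
    exact this.not_gt hδ
  have hmem : P (insert x T) := by
    refine ⟨by simpa [hx] using hT.1, ?_⟩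
    intro c hc d hd hcd
    rcases Finset.mem_insert.1 hc with rfl | hcT <;>
      rcases Finset.mem_insert.1 hd with rfl | hdT
    · exact absurd rfl hcd
    · exact (hfar d hdT).le
    · rw [dist_comm]
      exact (hfar c hcT).le
    · exact hT.2 c hcT d hdT hcd
  have := le_csSup hbdd ⟨_, hmem, rfl⟩
  rw [← hTcard, Finset.card_insert_of_notMem hxT] at this
  omega

/-- If every ball of radius `a` around a point of `S` fills a proportion `p` of `A`, then some ball of
radius `a` contains a proportion `p` of `S`. -/
theorem exists_center_of_measure_inter_ge {X : Type*} [PseudoMetricSpace X] [MeasurableSpace X]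
    [OpensMeasurableSpace X] (μ : Measure X) (A : Set X)
    (hA0 : μ A ≠ 0) (hAtop : μ A ≠ ⊤) (a p : ℝ) (S : Finset X)
    (h : ∀ x ∈ S, p * μ.real A ≤ μ.real (closedBall x a ∩ A)) :
    ∃ y, p * S.card ≤ ((S.filter fun x => dist x y ≤ a).card : ℝ) := by
  classical
  have hint (x : X) : IntegrableOn ((closedBall x a).indicator fun _ => (1 : ℝ)) A μ :=
    (integrableOn_const hAtop).indicator measurableSet_closedBall
  obtain ⟨y, -, hy⟩ := exists_setAverage_le hA0 hAtop
    (f := fun y => ∑ x ∈ S, (closedBall x a).indicator (fun _ => (1 : ℝ)) y)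
    (integrable_finsetSum _ fun x _ => hint x)
  refine ⟨y, ?_⟩
  have hcount : ∑ x ∈ S, (closedBall x a).indicator (fun _ => (1 : ℝ)) y =
      ((S.filter fun x => dist x y ≤ a).card : ℝ) := by
    simp [indicator_apply, dist_comm]
  rw [hcount, setAverage_eq, integral_finsetSum _ fun x _ => hint x] at hy
  refine le_trans ?_ hy
  have hpos : 0 < μ.real A := ENNReal.toReal_pos hA0 hAtop
  rw [smul_eq_mul, le_inv_mul_iff₀ hpos]
  calc μ.real A * (p * S.card) = ∑ x ∈ S, p * μ.real A := by
        rw [Finset.sum_const, nsmul_eq_mul]; ring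
    _ ≤ _ := Finset.sum_le_sum fun x hx => by
        rw [integral_indicator_const _ measurableSet_closedBall, smul_eq_mul, mul_one,
          measureReal_restrict_apply measurableSet_closedBall]
        exact h x hx

/-- Greedy covering: if every subset of `T` has a proportion `p` of its points in a single ball of
radius `a`, then `N` such balls can be chosen to leave out at most `(1 - p) ^ N * T.card` points. -/
theorem exists_greedy_centers {X : Type*} [PseudoMetricSpace X] (T : Finset X) (a p : ℝ)
    (hp : p ≤ 1)
    (h : ∀ S ⊆ T, ∃ y, p * S.card ≤ ((S.filter fun x => dist x y ≤ a).card : ℝ)) (N : ℕ) :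
    ∃ C : Finset X, C.card ≤ N ∧
      ((T.filter fun x => ∀ y ∈ C, a < dist x y).card : ℝ) ≤ (1 - p) ^ N * T.card := by
  classical
  induction N with
  | zero => exact ⟨∅, by simp⟩
  | succ N ih =>
    obtain ⟨C, hC, hrest⟩ := ih
    obtain ⟨y, hy⟩ := h _ (Finset.filter_subset (fun x => ∀ y ∈ C, a < dist x y) T)
    refine ⟨insert y C, (Finset.card_insert_le _ _).trans (by omega), ?_⟩
    set S := T.filter fun x => ∀ y ∈ C, a < dist x y
    have hsplit : (T.filter fun x => ∀ z ∈ insert y C, a < dist x z) =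
        S.filter fun x => ¬ dist x y ≤ a := by
      ext x
      simp only [S, Finset.mem_filter, Finset.forall_mem_insert, not_le]
      tauto
    have hcard : ((S.filter fun x => dist x y ≤ a).card : ℝ) +
        (S.filter fun x => ¬ dist x y ≤ a).card = S.card := by
      exact_mod_cast Finset.card_filter_add_card_filter_not (s := S) (fun x => dist x y ≤ a)
    rw [hsplit]
    calc _ ≤ (1 - p) * S.card := by linarith
      _ ≤ (1 - p) * ((1 - p) ^ N * T.card) :=
        mul_le_mul_of_nonneg_left hrest (by linarith)
      _ = _ := by ring

/-- The lens cut out of `ball 0 R` by a ball around `x` contains an ellipsoid, flattened by the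
factor `η` in the direction of `x`. -/
theorem measure_closedBall_inter_ge [MeasurableSpace E] [BorelSpace E] [Nontrivial E]
    (μ : Measure E) [μ.IsAddHaarMeasure] (x : E) (hx : ‖x‖ ≤ 1) (e η : ℝ)
    (he : 0 < e) (he1 : e < 1) (hη : 0 < η) (hη1 : η ≤ 1) :
    η * (e / (1 + η)) ^ finrank ℝ E * μ.real (closedBall (0 : E) (√(1 - e ^ 2) * (1 + η))) ≤
      μ.real (closedBall x (e * (1 + η)) ∩ closedBall (0 : E) (√(1 - e ^ 2) * (1 + η))) := by
  obtain ⟨u, t, hu, ht0, ht1, rfl⟩ : ∃ (u : E) (t : ℝ), ‖u‖ = 1 ∧ 0 ≤ t ∧ t ≤ 1 ∧ x = t • u := by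
    rcases eq_or_ne x 0 with rfl | hx0
    · obtain ⟨u, hu⟩ := exists_norm_eq E zero_le_one
      exact ⟨u, 0, hu, le_rfl, zero_le_one, by simp⟩
    · exact ⟨‖x‖⁻¹ • x, ‖x‖, norm_smul_inv_norm (𝕜 := ℝ) hx0, norm_nonneg x, hx,
        by rw [smul_inv_smul₀ (norm_ne_zero_iff.2 hx0)]⟩
  set r := √(1 - e ^ 2)
  have hc : 0 < 1 - e ^ 2 := by nlinarith
  have hr : 0 < r := Real.sqrt_pos.2 hc
  have hr2 : r ^ 2 = 1 - e ^ 2 := Real.sq_sqrt hc.le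
  have her : 2 * (e * r) ≤ 1 := by nlinarith [sq_nonneg (e - r)]
  let f : Module.Dual ℝ E := (innerSL ℝ u : E →L[ℝ] ℝ).toLinearMap
  let A : E →ₗ[ℝ] E := LinearMap.transvection f ((η - 1) • u)
  have hf (v : E) : f v = inner ℝ u v := rfl
  have huu : inner ℝ u u = (1 : ℝ) := by rw [real_inner_self_eq_norm_sq, hu, one_pow]
  have hdet : A.det = η := by
    rw [LinearMap.transvection.det, hf, inner_smul_right, huu]
    ring
  have hA (v : E) : A v = v + (inner ℝ u v * (η - 1)) • u := by
    simp [A, LinearMap.transvection.apply, hf, smul_smul]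
  have hnorm (b : ℝ) (v : E) : ‖b • u + A v‖ ^ 2 =
      b ^ 2 + 2 * b * η * inner ℝ u v + ‖v‖ ^ 2 - (1 - η ^ 2) * (inner ℝ u v) ^ 2 := by
    rw [hA, ← real_inner_self_eq_norm_sq, ← real_inner_self_eq_norm_sq]
    simp only [inner_add_left, inner_add_right, inner_smul_left, inner_smul_right, huu,
      real_inner_comm u v, conj_trivial]
    ring
  have hbound (b B : ℝ) (hbB : |b| ≤ B) (v : E) (hv : ‖v‖ ≤ e * r) :
      ‖b • u + A v‖ ^ 2 ≤ B ^ 2 + B * η + (e * r) ^ 2 := by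
    have hi : |inner ℝ u v| ≤ e * r := by
      simpa [hu] using (abs_real_inner_le_norm u v).trans
        (by simpa [hu] using hv : ‖u‖ * ‖v‖ ≤ e * r)
    have hb2 : b ^ 2 ≤ B ^ 2 := sq_le_sq' (abs_le.1 hbB).1 (abs_le.1 hbB).2
    have hv2 : ‖v‖ ^ 2 ≤ (e * r) ^ 2 := pow_le_pow_left₀ (norm_nonneg v) hv 2
    have hB : 0 ≤ B := (abs_nonneg b).trans hbB
    have hbi : b * inner ℝ u v ≤ B * (e * r) :=
      (le_abs_self _).trans (by rw [abs_mul]; exact mul_le_mul hbB hi (abs_nonneg _) hB)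
    have hη2 : 0 ≤ (1 - η ^ 2) * (inner ℝ u v) ^ 2 :=
      mul_nonneg (by nlinarith) (sq_nonneg _)
    rw [hnorm]
    nlinarith [mul_le_mul_of_nonneg_left hbi hη.le,
      mul_le_mul_of_nonneg_left her (mul_nonneg hB hη.le)]
  have hsub : (fun z => ((1 - e ^ 2) * t) • u + z) '' (A '' closedBall 0 (e * r)) ⊆
      closedBall (t • u) (e * (1 + η)) ∩ closedBall (0 : E) (r * (1 + η)) := by
    rintro _ ⟨_, ⟨v, hv, rfl⟩, rfl⟩
    rw [mem_closedBall_zero_iff] at hv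
    constructor
    · have := hbound (-(e ^ 2 * t)) (e ^ 2)
        (by rw [abs_neg, abs_of_nonneg (by positivity)]; nlinarith [sq_nonneg e]) v hv
      rw [mem_closedBall, dist_eq_norm]
      refine (sq_le_sq₀ (norm_nonneg _) (by positivity)).1 ?_
      rw [show ((1 - e ^ 2) * t) • u + A v - t • u = (-(e ^ 2 * t)) • u + A v by module]
      rw [mul_pow, hr2] at this
      nlinarith [mul_pos he he, mul_pos (mul_pos he he) hη,
        mul_pos (mul_pos he he) (mul_pos hη hη)]
    · have := hbound ((1 - e ^ 2) * t) (1 - e ^ 2)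
        (by rw [abs_of_nonneg (by positivity)]; nlinarith) v hv
      rw [mem_closedBall_zero_iff]
      refine (sq_le_sq₀ (norm_nonneg _) (by positivity)).1 ?_
      rw [mul_pow, hr2] at this ⊢
      nlinarith [mul_pos hc hη, mul_pos hc (mul_pos hη hη)]
  have hle := measureReal_mono (μ := μ) hsub
    ((measure_mono inter_subset_right).trans_lt measure_closedBall_lt_top).ne
  have hball {s : ℝ} (hs : 0 ≤ s) :
      μ.real (closedBall (0 : E) s) = s ^ finrank ℝ E * μ.real (ball 0 1) := by
    rw [Measure.real, Measure.addHaar_closedBall μ 0 hs, ENNReal.toReal_mul,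
      ENNReal.toReal_ofReal (by positivity), Measure.real]
  refine le_trans (le_of_eq ?_) hle
  rw [image_add_left, measureReal_def, measureReal_def, measure_preimage_add,
    Measure.addHaar_image_linearMap, hdet, ENNReal.toReal_mul, ← measureReal_def,
    ← measureReal_def, hball (by positivity), hball (by positivity), abs_of_pos hη,
    ENNReal.toReal_ofReal hη.le]
  rw [show e * r = (e / (1 + η)) * (r * (1 + η)) by field_simp,
    mul_pow (e / (1 + η))]
  ring

theorem coveringNumber_unit_ball_le_of_density [MeasurableSpace E] [BorelSpace E] [Nontrivial E]
    (e η : ℝ) (he : 0 < e) (he1 : e < 1) (hη : 0 < η) (hη1 : η ≤ 1) (N : ℕ) :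
    (coveringNumber (e * (1 + 2 * η)) (closedBall (0 : E) 1) : ℝ) ≤
      N + (1 - η * (e / (1 + η)) ^ finrank ℝ E) ^ N * (1 + 2 / (e * η)) ^ finrank ℝ E := by
  classical
  set p := η * (e / (1 + η)) ^ finrank ℝ E
  have hp1 : p ≤ 1 := mul_le_one₀ hη1 (by positivity)
    (pow_le_one₀ (by positivity) ((div_le_one (by positivity)).2 (by linarith)))
  obtain ⟨T, hT, hTcard, hTnet⟩ := exists_net_unit_ball (E := E) (e * η) (by positivity)
  have hR : 0 < √(1 - e ^ 2) * (1 + η) :=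
    mul_pos (Real.sqrt_pos.2 (by nlinarith)) (by positivity)
  obtain ⟨C, hC, hrest⟩ := exists_greedy_centers T (e * (1 + η)) p hp1
    (fun S hS => exists_center_of_measure_inter_ge Measure.addHaar
      (closedBall (0 : E) (√(1 - e ^ 2) * (1 + η))) (measure_closedBall_pos _ _ hR).ne'
      measure_closedBall_lt_top.ne _ p S fun x hx =>
        measure_closedBall_inter_ge _ x (hT x (hS hx)) e η he he1 hη hη1) N
  set U := T.filter fun x => ∀ y ∈ C, e * (1 + η) < dist x y
  have hcover : coveringNumber (e * (1 + 2 * η)) (closedBall (0 : E) 1) ≤ (C ∪ U).card := by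
    refine Nat.sInf_le ⟨C ∪ U, rfl, fun x hx => ?_⟩
    obtain ⟨z, hz, hxz⟩ := hTnet x (mem_closedBall_zero_iff.1 hx)
    by_cases hzU : z ∈ U
    · exact ⟨z, Finset.mem_union_right _ hzU, by nlinarith⟩
    · obtain ⟨y, hy, hzy⟩ : ∃ y ∈ C, dist z y ≤ e * (1 + η) := by
        simpa [U, hz] using hzU
      exact ⟨y, Finset.mem_union_left _ hy, by linarith [dist_triangle x z y]⟩
  calc (coveringNumber (e * (1 + 2 * η)) (closedBall (0 : E) 1) : ℝ)
      ≤ (C.card : ℝ) + U.card := mod_cast hcover.trans (Finset.card_union_le _ _)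
    _ ≤ N + (1 - p) ^ N * T.card := add_le_add (mod_cast hC) hrest
    _ ≤ _ := by
      have : 0 ≤ (1 - p) ^ N := pow_nonneg (by linarith) N
      gcongr

/-- The covering number of the unit ball is at most `ε⁻¹ ^ n` up to a factor polynomial in the
dimension `n`, uniformly in `ε`. -/
theorem coveringNumber_unit_ball_le [Nontrivial E] (ε : ℝ) (hε : 0 < ε) (hε1 : ε < 1) :
    (coveringNumber ε (closedBall (0 : E) 1) : ℝ) ≤
      200 * (finrank ℝ E : ℝ) ^ 3 * ε⁻¹ ^ finrank ℝ E := by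
  borelize E
  have hn : 0 < finrank ℝ E := finrank_pos
  set n := finrank ℝ E
  have hn1 : (1 : ℝ) ≤ n := mod_cast hn
  have hn0 : (0 : ℝ) < n := by linarith
  set η : ℝ := (n : ℝ)⁻¹
  have hη : 0 < η := by positivity
  have hη1 : η ≤ 1 := inv_le_one_of_one_le₀ hn1
  have hnη : n * η = 1 := mul_inv_cancel₀ hn0.ne'
  set e : ℝ := ε / (1 + 2 * η)
  have he : 0 < e := by positivity
  have he1 : e < 1 := (div_le_self hε.le (by linarith)).trans_lt hε1
  set p : ℝ := η * (e / (1 + η)) ^ n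
  have hp : 0 < p := by positivity
  have hp1 : p ≤ 1 := mul_le_one₀ hη1 (by positivity)
    (pow_le_one₀ (by positivity) ((div_le_one (by positivity)).2 (by linarith)))
  have hεn : 1 ≤ ε⁻¹ ^ n := one_le_pow₀ ((one_le_inv₀ hε).2 hε1.le)
  have hpinv : p⁻¹ ≤ 27 * n * ε⁻¹ ^ n := by
    have h1 : (1 + 2 * η) * (1 + η) ≤ Real.exp (3 * η) := by
      rw [show 3 * η = 2 * η + η by ring, Real.exp_add]
      exact mul_le_mul (by linarith [Real.add_one_le_exp (2 * η)])
        (by linarith [Real.add_one_le_exp η]) (by positivity) (Real.exp_pos _).le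
    have h2 : ((1 + 2 * η) * (1 + η)) ^ n ≤ 27 := by
      calc _ ≤ Real.exp (3 * η) ^ n := pow_le_pow_left₀ (by positivity) h1 n
        _ = Real.exp 1 ^ 3 := by
          rw [← Real.exp_nat_mul, ← Real.exp_nat_mul]
          congr 1
          push_cast
          linear_combination 3 * hnη
        _ ≤ 3 ^ 3 := pow_le_pow_left₀ (Real.exp_pos _).le
          (by linarith [Real.exp_one_lt_d9]) 3
        _ = 27 := by norm_num
    calc p⁻¹ = n * ((1 + 2 * η) * (1 + η)) ^ n * ε⁻¹ ^ n := by
          rw [mul_assoc, ← mul_pow, mul_inv, inv_inv, ← inv_pow]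
          congr 2
          simp only [e]
          field_simp
      _ ≤ n * 27 * ε⁻¹ ^ n := by gcongr
      _ = _ := by ring
  set N := ⌈7 * (n : ℝ) ^ 2 * p⁻¹⌉₊
  have hN : (N : ℝ) ≤ 7 * n ^ 2 * p⁻¹ + 1 := (Nat.ceil_lt_add_one (by positivity)).le
  have hN' : 7 * (n : ℝ) ^ 2 ≤ p * N := by
    have := Nat.le_ceil (7 * (n : ℝ) ^ 2 * p⁻¹)
    rwa [← div_eq_mul_inv, div_le_iff₀' hp] at this
  have hrest : (1 - p) ^ N * (1 + 2 / (e * η)) ^ n ≤ ε⁻¹ ^ n := by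
    have h1 : (1 - p) ^ N ≤ Real.exp (-(7 * (n : ℝ) ^ 2)) := by
      calc (1 - p) ^ N ≤ Real.exp (-p) ^ N :=
            pow_le_pow_left₀ (by linarith) (Real.one_sub_le_exp_neg p) N
        _ = Real.exp (-(p * N)) := by rw [← Real.exp_nat_mul]; ring_nf
        _ ≤ _ := Real.exp_le_exp.2 (by linarith)
    have h2 : 1 + 2 / (e * η) ≤ Real.exp (7 * n) * ε⁻¹ := by
      have hεi : 1 ≤ ε⁻¹ := (one_le_inv₀ hε).2 hε1.le
      have heq : 2 / (e * η) = (2 * n + 4) * ε⁻¹ := by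
        simp only [e, η]
        field_simp
        ring
      rw [heq]
      nlinarith [Real.add_one_le_exp (7 * (n : ℝ))]
    calc _ ≤ Real.exp (-(7 * (n : ℝ) ^ 2)) * (Real.exp (7 * n) * ε⁻¹) ^ n := by gcongr
      _ = ε⁻¹ ^ n := by
        rw [mul_pow, ← Real.exp_nat_mul, ← mul_assoc, ← Real.exp_add,
          show -(7 * (n : ℝ) ^ 2) + n * (7 * n) = 0 by ring, Real.exp_zero, one_mul]
  have hmain := coveringNumber_unit_ball_le_of_density (E := E) e η he he1 hη hη1 N
  rw [show e * (1 + 2 * η) = ε from div_mul_cancel₀ _ (by positivity)] at hmain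
  have hn3 : 1 ≤ (n : ℝ) ^ 3 := one_le_pow₀ hn1
  calc _ ≤ _ := hmain
    _ ≤ 7 * (n : ℝ) ^ 2 * (27 * n * ε⁻¹ ^ n) + 1 + ε⁻¹ ^ n := by
      refine add_le_add (hN.trans ?_) hrest
      gcongr
    _ ≤ _ := by nlinarith

end UnitBall

theorem tendsto_mul_pow_rpow_inv_atTop (c : ℝ) (hc : 0 < c) (k : ℕ) :
    Tendsto (fun x : ℝ => (c * x ^ k) ^ (1 / x)) atTop (nhds 1) := by
  have h1 : Tendsto (fun x : ℝ => c ^ (1 / x)) atTop (nhds 1) := by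
    simpa [one_div] using (tendsto_const_nhds (x := c)).rpow tendsto_inv_atTop_zero (Or.inl hc.ne')
  have h2 : Tendsto (fun x : ℝ => (x ^ (1 / x)) ^ k) atTop (nhds 1) := by
    simpa using tendsto_rpow_div.pow k
  have h3 := h1.mul h2
  rw [one_mul] at h3
  refine h3.congr' ?_
  filter_upwards [eventually_gt_atTop 0] with x hx
  rw [Real.mul_rpow hc.le (by positivity), ← Real.rpow_natCast, ← Real.rpow_natCast,
    ← Real.rpow_mul hx.le, ← Real.rpow_mul hx.le, mul_comm (1 / x)]

theorem covering_number_unit_ball_complex :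
    ∃ κ : ℕ → ℝ, Tendsto κ atTop (nhds 1) ∧
      ∀ d : ℕ, 0 < d → ∀ ε : ℝ, ε ∈ Set.Ioo (0 : ℝ) 1 →
        (coveringNumber ε (Metric.closedBall (0 : EuclideanSpace ℂ (Fin d)) 1) : ℝ)
            ^ (1 / (2 * (d : ℝ))) * ε ≤ κ d := by
  refine ⟨fun d => (200 * (2 * (d : ℝ)) ^ 3) ^ (1 / (2 * (d : ℝ))),
    (tendsto_mul_pow_rpow_inv_atTop 200 (by norm_num) 3).comp
      (tendsto_natCast_atTop_atTop.const_mul_atTop two_pos), ?_⟩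
  rintro d hd ε ⟨hε, hε1⟩
  let _ : InnerProductSpace ℝ (EuclideanSpace ℂ (Fin d)) := InnerProductSpace.rclikeToReal ℂ _
  have : FiniteDimensional ℝ (EuclideanSpace ℂ (Fin d)) := FiniteDimensional.complexToReal _
  have : Nonempty (Fin d) := ⟨⟨0, hd⟩⟩
  have hfin : Module.finrank ℝ (EuclideanSpace ℂ (Fin d)) = 2 * d := by
    rw [finrank_real_of_complex, finrank_euclideanSpace_fin]
  have hle := coveringNumber_unit_ball_le (E := EuclideanSpace ℂ (Fin d)) ε hε hε1
  rw [hfin] at hle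
  push_cast at hle
  have hd0 : (0 : ℝ) < 2 * d := by positivity
  calc _ ≤ (200 * (2 * (d : ℝ)) ^ 3 * ε⁻¹ ^ (2 * d)) ^ (1 / (2 * (d : ℝ))) * ε := by gcongr
    _ = _ := by
      rw [Real.mul_rpow (by positivity) (by positivity), ← Real.rpow_natCast ε⁻¹,
        ← Real.rpow_mul (by positivity)]
      push_cast
      rw [mul_one_div_cancel hd0.ne', Real.rpow_one, mul_assoc, inv_mul_cancel₀ hε.ne', mul_one]
end
end
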